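/- Let α ∈ [1,2] and r ∈ (1/2, (α+1)/2]. Let φ(x) = ∫_{−∞}^x ⟨s⟩^{−2r} ds and ϕ = ⟨x⟩^{−r}. There exists C > 0 such that for all real-valued u in the Schwartz class, ∫ (−|D|^α u) (∂_x u) φ(x) dx ≤ −((α−1)/2) ∫ (|D|^{α/2}(ϕ u))² dx + C ∫ u² φ'(x) dx. -/

import Mathlib

open MeasureTheory Complex ComplexConjugate

noncomputable section

/-- Japanese bracket `⟨x⟩ = (1+x²)^{1/2}`. -/
def jap (x : ℝ) : ℝ := Real.sqrt (1 + x ^ 2)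

/-- Fourier transform with the convention `û(ξ) = ∫ e^{-ixξ} u(x) dx`. -/
def FT (u : ℝ → ℂ) (ξ : ℝ) : ℂ := ∫ x : ℝ, Complex.exp (-(Complex.I * (x : ℂ) * (ξ : ℂ))) * u x

/-- Inverse Fourier transform `(1/2π) ∫ e^{ixξ} v(ξ) dξ`. -/
def FTinv (v : ℝ → ℂ) (x : ℝ) : ℂ :=
  ((2 * Real.pi)⁻¹ : ℝ) • ∫ ξ : ℝ, Complex.exp (Complex.I * (x : ℂ) * (ξ : ℂ)) * v ξ

/-- The Fourier multiplier `|D|^α` with symbol `|ξ|^α`. -/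
def fracD (α : ℝ) (u : ℝ → ℂ) : ℝ → ℂ :=
  FTinv (fun ξ => ((|ξ| ^ α : ℝ) : ℂ) * FT u ξ)

end

open scoped FourierTransform SchwartzMap

theorem FT_eq_fourier (u : ℝ → ℂ) (ξ : ℝ) : FT u ξ = 𝓕 u (ξ / (2 * Real.pi)) := by
  rw [FT, Real.fourier_real_eq_integral_exp_smul]
  congr 1 with x
  rw [smul_eq_mul]
  congr 2
  push_cast
  field_simp

theorem FTinv_eq_integral (v : ℝ → ℂ) (x : ℝ) :
    FTinv v x = ∫ η : ℝ, Complex.exp (2 * Real.pi * Complex.I * x * η) * v (2 * Real.pi * η) := by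
  have h := Measure.integral_comp_mul_left
    (fun ξ : ℝ => Complex.exp (Complex.I * (x : ℂ) * (ξ : ℂ)) * v ξ) (2 * Real.pi)
  rw [FTinv, ← abs_of_pos (a := (2 * Real.pi)⁻¹) (by positivity), ← h]
  congr 1 with η
  congr 2
  push_cast
  ring

theorem fracD_eq_integral (α : ℝ) (u : ℝ → ℂ) (x : ℝ) :
    fracD α u x = ∫ η : ℝ, Complex.exp (2 * Real.pi * Complex.I * x * η)
      * (((|2 * Real.pi * η| ^ α : ℝ) : ℂ) * 𝓕 u η) := by
  rw [fracD, FTinv_eq_integral]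
  congr 1 with η
  rw [FT_eq_fourier, mul_div_cancel_left₀ _ (by positivity)]

theorem fracD_eq_fourierInv (α : ℝ) (u : ℝ → ℂ) :
    fracD α u = 𝓕⁻ (fun η : ℝ => ((|2 * Real.pi * η| ^ α : ℝ) : ℂ) * 𝓕 u η) := by
  ext x
  rw [fracD_eq_integral, Real.fourierInv_eq']
  congr 1 with η
  rw [smul_eq_mul]
  congr 2
  simp
  ring

theorem continuous_symbol_mul_fourier {α : ℝ} (hα : 0 ≤ α) (V : 𝓢(ℝ, ℂ)) :
    Continuous (fun η : ℝ => ((|2 * Real.pi * η| ^ α : ℝ) : ℂ) * 𝓕 (V : ℝ → ℂ) η) := by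
  have h1 : Continuous (𝓕 (V : ℝ → ℂ)) := (𝓕 V).continuous
  have h2 : Continuous (fun η : ℝ => |2 * Real.pi * η| ^ α) :=
    (by fun_prop : Continuous fun η : ℝ => |2 * Real.pi * η|).rpow_const fun _ => Or.inr hα
  fun_prop

theorem exists_norm_symbol_mul_fourier_le {α : ℝ} (hα : 0 ≤ α) (V : 𝓢(ℝ, ℂ)) :
    ∃ C, ∀ η : ℝ, ‖((|2 * Real.pi * η| ^ α : ℝ) : ℂ) * 𝓕 (V : ℝ → ℂ) η‖ ≤ C * (1 + η ^ 2)⁻¹ := by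
  obtain ⟨n, hn⟩ := exists_nat_ge α
  have hd : ∀ k : ℕ, ∀ η : ℝ, |η| ^ k * ‖𝓕 (V : ℝ → ℂ) η‖ ≤ SchwartzMap.seminorm ℝ k 0 (𝓕 V) := by
    intro k η
    exact SchwartzMap.norm_pow_mul_le_seminorm ℝ (𝓕 V) k η
  set S := fun k : ℕ => SchwartzMap.seminorm ℝ k 0 (𝓕 V)
  refine ⟨(2 * Real.pi) ^ α * (S 0 + S n + S 2 + S (n + 2)), fun η => ?_⟩
  rw [norm_mul, Complex.norm_real, Real.norm_of_nonneg (by positivity), abs_mul,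
    abs_of_pos (by positivity : 0 < 2 * Real.pi), Real.mul_rpow (by positivity) (by positivity),
    mul_assoc, mul_assoc]
  refine mul_le_mul_of_nonneg_left ?_ (by positivity)
  rw [← div_eq_mul_inv, le_div_iff₀ (by positivity)]
  have h1 : |η| ^ α ≤ 1 + |η| ^ n := by
    rcases le_total |η| 1 with h | h
    · have := Real.rpow_le_one (abs_nonneg η) h hα
      have : 0 ≤ |η| ^ n := by positivity
      linarith
    · have := Real.rpow_le_rpow_of_exponent_le h hn
      rw [Real.rpow_natCast] at this
      linarith
  have e0 := hd 0 η
  have e1 := hd n η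
  have e2 := hd 2 η
  have e3 := hd (n + 2) η
  calc |η| ^ α * ‖𝓕 (V : ℝ → ℂ) η‖ * (1 + η ^ 2)
      ≤ (1 + |η| ^ n) * ‖𝓕 (V : ℝ → ℂ) η‖ * (1 + η ^ 2) := by gcongr
    _ = |η| ^ 0 * ‖𝓕 (V : ℝ → ℂ) η‖ + |η| ^ n * ‖𝓕 (V : ℝ → ℂ) η‖
        + |η| ^ 2 * ‖𝓕 (V : ℝ → ℂ) η‖ + |η| ^ (n + 2) * ‖𝓕 (V : ℝ → ℂ) η‖ := by
      rw [← sq_abs]; ring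
    _ ≤ _ := by gcongr

theorem integrable_symbol_mul_fourier {α : ℝ} (hα : 0 ≤ α) (V : 𝓢(ℝ, ℂ)) :
    Integrable (fun η : ℝ => ((|2 * Real.pi * η| ^ α : ℝ) : ℂ) * 𝓕 (V : ℝ → ℂ) η) := by
  obtain ⟨C, hC⟩ := exists_norm_symbol_mul_fourier_le hα V
  exact (integrable_inv_one_add_sq.const_mul C).mono'
    (continuous_symbol_mul_fourier hα V).aestronglyMeasurable (.of_forall hC)

theorem memLp_two_symbol_mul_fourier {α : ℝ} (hα : 0 ≤ α) (V : 𝓢(ℝ, ℂ)) :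
    MemLp (fun η : ℝ => ((|2 * Real.pi * η| ^ α : ℝ) : ℂ) * 𝓕 (V : ℝ → ℂ) η) 2 := by
  rw [memLp_two_iff_integrable_sq_norm (continuous_symbol_mul_fourier hα V).aestronglyMeasurable]
  obtain ⟨C, hC⟩ := exists_norm_symbol_mul_fourier_le hα V
  refine ((integrable_symbol_mul_fourier hα V).norm.const_mul C).mono'
    ((continuous_symbol_mul_fourier hα V).norm.pow 2).aestronglyMeasurable (.of_forall fun η => ?_)
  have h0 := hC η
  have h1 : (1 + η ^ 2)⁻¹ ≤ 1 := inv_le_one_of_one_le₀ (by nlinarith)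
  have h2 : 0 < (1 + η ^ 2)⁻¹ := by positivity
  have hC0 : 0 ≤ C := by
    have := (norm_nonneg _).trans h0
    exact nonneg_of_mul_nonneg_left this h2
  rw [Real.norm_of_nonneg (by positivity), sq]
  exact mul_le_mul_of_nonneg_right (h0.trans (mul_le_of_le_one_right hC0 h1)) (norm_nonneg _)

theorem integral_mul_fourierInv_eq {g h : ℝ → ℂ} (hg : Integrable g) (hh : Integrable h) :
    ∫ x, g x * 𝓕⁻ h x = ∫ x, 𝓕⁻ g x * h x := by
  have := VectorFourier.integral_fourierIntegral_smul_eq_flip (μ := volume) (ν := volume)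
    (L := -innerₗ ℝ) Real.continuous_fourierChar
    (continuous_inner (𝕜 := ℝ)).neg hg hh
  have hflip : (-innerₗ ℝ).flip = -innerₗ ℝ := by
    ext; simp
  rw [hflip] at this
  exact this.symm

/-- Plancherel's identity for the integral Fourier transform of a function in `L¹ ∩ L²`. -/
theorem integral_norm_sq_fourierInv {h : ℝ → ℂ} (h1 : Integrable h) (h2 : MemLp h 2) :
    ∫ x, ‖𝓕⁻ h x‖ ^ 2 = ∫ x, ‖h x‖ ^ 2 := by
  set f : Lp ℂ 2 (volume : Measure ℝ) := h2.toLp h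
  have hc : Continuous (𝓕⁻ h) := by
    have : 𝓕⁻ h = fun x => 𝓕 h (-x) := by
      ext x; rw [Real.fourierInv_eq_fourier_neg]
    rw [this]
    exact (VectorFourier.fourierIntegral_continuous Real.continuous_fourierChar
      (by fun_prop) h1).comp continuous_neg
  have hae : ∀ᵐ x, 𝓕⁻ h x = (𝓕⁻ f : Lp ℂ 2 (volume : Measure ℝ)) x := by
    refine ae_eq_of_integral_contDiff_smul_eq (hc.locallyIntegrable)
      ((Lp.memLp (𝓕⁻ f)).locallyIntegrable (by norm_num)) ?_
    intro g hg hgs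
    have hgs' : HasCompactSupport fun x => (g x : ℂ) := hgs.comp_left Complex.ofReal_zero
    set G : 𝓢(ℝ, ℂ) := hgs'.toSchwartzMap (Complex.ofRealCLM.contDiff.comp hg)
    have hL2 := congrArg (fun T => T G) (Lp.fourierInv_toTemperedDistribution_eq f)
    simp only [TemperedDistribution.fourierInv_apply, Lp.toTemperedDistribution_apply,
      smul_eq_mul] at hL2
    have e1 : ∀ x, g x • 𝓕⁻ h x = G x * 𝓕⁻ h x := fun x => Complex.real_smul
    have e2 : ∀ x, g x • (𝓕⁻ f : Lp ℂ 2 (volume : Measure ℝ)) x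
        = G x * (𝓕⁻ f : Lp ℂ 2 (volume : Measure ℝ)) x := fun x => Complex.real_smul
    simp only [e1, e2]
    rw [← hL2, integral_mul_fourierInv_eq G.integrable h1]
    refine integral_congr_ae ?_
    filter_upwards [h2.coeFn_toLp] with x hx
    rw [hx, SchwartzMap.fourierInv_coe]
  have hn : ‖(𝓕⁻ f : Lp ℂ 2 (volume : Measure ℝ))‖ = ‖f‖ := by
    rw [← Lp.norm_fourier_eq, FourierTransform.fourier_fourierInv_eq]
  have hsq : ∀ F : Lp ℂ 2 (volume : Measure ℝ), ((∫ x, ‖F x‖ ^ 2 : ℝ) : ℂ) = ‖F‖ ^ 2 := by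
    intro F
    have := L2.inner_def (𝕜 := ℂ) F F
    rw [inner_self_eq_norm_sq_to_K] at this
    rw [← integral_complex_ofReal]
    refine Eq.trans ?_ this.symm
    congr 1 with x
    rw [inner_self_eq_norm_sq_to_K]
    simp
  have e1 : ∫ x, ‖𝓕⁻ h x‖ ^ 2 = ∫ x, ‖(𝓕⁻ f : Lp ℂ 2 (volume : Measure ℝ)) x‖ ^ 2 :=
    integral_congr_ae (hae.mono fun x hx => by simp only [hx])
  have e2 : ∫ x, ‖h x‖ ^ 2 = ∫ x, ‖f x‖ ^ 2 :=
    integral_congr_ae (h2.coeFn_toLp.mono fun x hx => by simp only [f, hx])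
  rw [e1, e2]
  have := (hsq (𝓕⁻ f)).trans ((congrArg (fun a : ℝ => (a : ℂ) ^ 2) hn).trans (hsq f).symm)
  exact_mod_cast this

theorem integral_norm_sq_fracD_half {α : ℝ} (hα : 0 ≤ α) (V : 𝓢(ℝ, ℂ)) :
    ∫ x, ‖fracD (α / 2) V x‖ ^ 2 = (∫ x, fracD α V x * conj (V x)).re := by
  have hα2 : 0 ≤ α / 2 := by positivity
  have hV : Integrable fun x => conj (V x) :=
    Complex.conjCLE.toContinuousLinearMap.integrable_comp (V.integrable (μ := volume))
  have hinv : ∀ η : ℝ, 𝓕⁻ (fun x => conj (V x)) η = conj (𝓕 (V : ℝ → ℂ) η) := by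
    intro η
    rw [Real.fourierInv_eq', Real.fourier_eq', ← integral_conj]
    congr 1 with x
    simp [← Complex.exp_conj, Complex.conj_ofNat]
  rw [fracD_eq_fourierInv, fracD_eq_fourierInv, integral_norm_sq_fourierInv
    (integrable_symbol_mul_fourier hα2 V) (memLp_two_symbol_mul_fourier hα2 V)]
  have := integral_mul_fourierInv_eq hV (integrable_symbol_mul_fourier hα V)
  simp only [mul_comm _ (conj (V _))]
  rw [this, ← Complex.ofReal_re (∫ x, _), ← integral_complex_ofReal]
  congr 2 with η
  rw [hinv, norm_mul, Complex.norm_real, Real.norm_of_nonneg (by positivity), mul_pow,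
    ← Real.rpow_natCast, ← Real.rpow_mul (abs_nonneg _), mul_left_comm, mul_comm (conj _),
    Complex.mul_conj, Complex.normSq_eq_norm_sq]
  norm_num

theorem integrableOn_Ioi_of_bounds {α C : ℝ} (h0 : 0 < α) (h2 : α < 2) {f : ℝ → ℝ}
    (hf : AEStronglyMeasurable f (volume.restrict (Set.Ioi 0)))
    (hsmall : ∀ t, 0 < t → t ≤ 1 → |f t| ≤ C * t ^ 2) (hlarge : ∀ t, 1 < t → |f t| ≤ C) :
    IntegrableOn (fun t : ℝ => t ^ (-1 - α) * f t) (Set.Ioi 0) := by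
  have hm : AEStronglyMeasurable (fun t : ℝ => t ^ (-1 - α) * f t) (volume.restrict (Set.Ioi 0)) :=
    (by fun_prop : Measurable fun t : ℝ => t ^ (-1 - α)).aestronglyMeasurable.mul hf
  rw [← Set.Ioc_union_Ioi_eq_Ioi zero_le_one]
  refine IntegrableOn.union ?_ ?_
  · have h := (intervalIntegral.intervalIntegrable_rpow' (a := 0) (b := 1) (r := 1 - α)
      (by linarith)).const_mul C
    rw [intervalIntegrable_iff_integrableOn_Ioc_of_le zero_le_one] at h
    refine Integrable.mono' h (hm.mono_measure (Measure.restrict_mono Set.Ioc_subset_Ioi_self le_rfl))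
      ((ae_restrict_iff' measurableSet_Ioc).2 (.of_forall fun t ht => ?_))
    have e : t ^ (1 - α) = t ^ (-1 - α) * t ^ 2 := by
      rw [← Real.rpow_natCast, ← Real.rpow_add ht.1]; congr 1; push_cast; ring
    rw [norm_mul, Real.norm_of_nonneg (Real.rpow_nonneg ht.1.le _), Real.norm_eq_abs, e]
    calc _ ≤ t ^ (-1 - α) * (C * t ^ 2) :=
          mul_le_mul_of_nonneg_left (hsmall t ht.1 ht.2) (Real.rpow_nonneg ht.1.le _)
      _ = _ := by ring
  · have h := (integrableOn_Ioi_rpow_of_lt (a := -1 - α) (by linarith) zero_lt_one).const_mul C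
    refine Integrable.mono' h (hm.mono_measure (Measure.restrict_mono
      (Set.Ioi_subset_Ioi zero_le_one) le_rfl))
      ((ae_restrict_iff' measurableSet_Ioi).2 (.of_forall fun t ht => ?_))
    have ht0 : 0 < t := zero_lt_one.trans ht
    rw [norm_mul, Real.norm_of_nonneg (Real.rpow_nonneg ht0.le _), Real.norm_eq_abs, mul_comm]
    exact mul_le_mul_of_nonneg_right (hlarge t ht) (Real.rpow_nonneg ht0.le _)

theorem integrableOn_rpow_mul_one_sub_cos {α : ℝ} (h0 : 0 < α) (h2 : α < 2) (b : ℝ) :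
    IntegrableOn (fun t : ℝ => t ^ (-1 - α) * (1 - Real.cos (b * t))) (Set.Ioi 0) := by
  refine integrableOn_Ioi_of_bounds (C := b ^ 2 + 2) h0 h2
    (by fun_prop : Continuous fun t : ℝ => 1 - Real.cos (b * t)).aestronglyMeasurable ?_ ?_
  · intro t _ _
    have := Real.one_sub_sq_div_two_le_cos (x := b * t)
    have := Real.cos_le_one (b * t)
    rw [abs_of_nonneg (by linarith)]
    nlinarith [sq_nonneg (b * t), sq_nonneg t]
  · intro t _
    have := Real.neg_one_le_cos (b * t)
    have := Real.cos_le_one (b * t)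
    rw [abs_of_nonneg (by linarith)]
    nlinarith [sq_nonneg b]

/-- The constant in `∫₀^∞ (1 - cos (b t)) t^{-1-α} dt = c |b|^α`. -/
noncomputable def fracConst (α : ℝ) : ℝ := ∫ t in Set.Ioi (0 : ℝ), t ^ (-1 - α) * (1 - Real.cos t)

theorem fracConst_pos {α : ℝ} (h0 : 0 < α) (h2 : α < 2) : 0 < fracConst α := by
  have hi := integrableOn_rpow_mul_one_sub_cos h0 h2 1
  simp only [one_mul] at hi
  have hnn : ∀ t ∈ Set.Ioi (0 : ℝ), 0 ≤ t ^ (-1 - α) * (1 - Real.cos t) := fun t ht =>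
    mul_nonneg (Real.rpow_nonneg (le_of_lt ht) _) (by linarith [Real.cos_le_one t])
  rw [fracConst, setIntegral_pos_iff_support_of_nonneg_ae
    ((ae_restrict_iff' measurableSet_Ioi).2 (.of_forall hnn)) hi]
  refine lt_of_lt_of_le ?_ (measure_mono (s := Set.Ioo (0 : ℝ) 1) ?_)
  · simp
  · intro t ht
    refine ⟨?_, ht.1⟩
    have : Real.cos t < 1 := by
      have := Real.cos_lt_cos_of_nonneg_of_le_pi le_rfl
        (by linarith [ht.2, Real.pi_gt_three] : t ≤ Real.pi) ht.1
      simpa using this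
    exact mul_ne_zero (Real.rpow_pos_of_pos ht.1 _).ne' (by linarith)

theorem integral_rpow_mul_one_sub_cos {α : ℝ} (h0 : 0 < α) (b : ℝ) :
    ∫ t in Set.Ioi (0 : ℝ), t ^ (-1 - α) * (1 - Real.cos (b * t)) = fracConst α * |b| ^ α := by
  rcases eq_or_ne b 0 with rfl | hb
  · simp [Real.zero_rpow h0.ne']
  have hb' : 0 < |b| := abs_pos.2 hb
  have h := integral_comp_mul_left_Ioi (fun t : ℝ => t ^ (-1 - α) * (1 - Real.cos t)) 0 hb'
  rw [mul_zero] at h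
  have e : ∀ t ∈ Set.Ioi (0 : ℝ), t ^ (-1 - α) * (1 - Real.cos (b * t))
      = |b| ^ (1 + α) * ((|b| * t) ^ (-1 - α) * (1 - Real.cos (|b| * t))) := by
    intro t ht
    have h1 : Real.cos (b * t) = Real.cos (|b| * t) := by
      rcases abs_choice b with h | h <;> rw [h]
      rw [neg_mul, Real.cos_neg]
    rw [h1, Real.mul_rpow hb'.le (le_of_lt ht), ← mul_assoc, ← mul_assoc, ← Real.rpow_add hb']
    norm_num
  rw [setIntegral_congr_fun measurableSet_Ioi e, integral_const_mul, h, fracConst, smul_eq_mul,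
    Real.rpow_add hb', Real.rpow_one]
  field_simp

theorem integral_exp_mul_fourier (V : 𝓢(ℝ, ℂ)) (x : ℝ) :
    ∫ η : ℝ, Complex.exp (2 * Real.pi * Complex.I * x * η) * 𝓕 (V : ℝ → ℂ) η = V x := by
  have h := congrArg (fun f : 𝓢(ℝ, ℂ) => f x)
    (FourierTransform.fourierInv_fourier_eq (F := 𝓢(ℝ, ℂ)) V)
  simp only [SchwartzMap.fourierInv_coe, SchwartzMap.fourier_coe] at h
  rw [← h, Real.fourierInv_eq']
  congr 1 with η
  rw [smul_eq_mul]
  congr 2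
  simp
  ring

theorem integral_one_sub_cos_mul_fourier (V : 𝓢(ℝ, ℂ)) (x t : ℝ) :
    ∫ η : ℝ, ((1 - Real.cos (2 * Real.pi * η * t) : ℝ) : ℂ) *
      (Complex.exp (2 * Real.pi * Complex.I * x * η) * 𝓕 (V : ℝ → ℂ) η)
      = (2 * V x - V (x + t) - V (x - t)) / 2 := by
  have hi : ∀ y : ℝ, Integrable fun η : ℝ =>
      Complex.exp (2 * Real.pi * Complex.I * y * η) * 𝓕 (V : ℝ → ℂ) η := by
    intro y
    refine (𝓕 V).integrable.norm.mono' (Continuous.aestronglyMeasurable ?_) (.of_forall fun η => ?_)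
    · have : Continuous (𝓕 (V : ℝ → ℂ)) := (𝓕 V).continuous
      fun_prop
    · rw [norm_mul, Complex.norm_exp]
      simp [SchwartzMap.fourier_coe]
  have hs : Integrable fun η : ℝ =>
      2 * (Complex.exp (2 * Real.pi * Complex.I * x * η) * 𝓕 (V : ℝ → ℂ) η)
      - Complex.exp (2 * Real.pi * Complex.I * ((x + t : ℝ) : ℂ) * η) * 𝓕 (V : ℝ → ℂ) η :=
    ((hi x).const_mul 2).sub (hi (x + t))
  rw [← integral_exp_mul_fourier V x, ← integral_exp_mul_fourier V (x + t),
    ← integral_exp_mul_fourier V (x - t), ← integral_const_mul, ← integral_sub ((hi x).const_mul 2)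
    (hi _), ← integral_sub hs (hi _), ← integral_div]
  congr 1 with η
  have e1 : Complex.exp (2 * Real.pi * Complex.I * ((x + t : ℝ) : ℂ) * η)
      = Complex.exp (2 * Real.pi * Complex.I * x * η)
        * Complex.exp (((2 * Real.pi * η * t : ℝ) : ℂ) * Complex.I) := by
    rw [← Complex.exp_add]; congr 1; push_cast; ring
  have e2 : Complex.exp (2 * Real.pi * Complex.I * ((x - t : ℝ) : ℂ) * η)
      = Complex.exp (2 * Real.pi * Complex.I * x * η)
        * Complex.exp (-((2 * Real.pi * η * t : ℝ) : ℂ) * Complex.I) := by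
    rw [← Complex.exp_add]; congr 1; push_cast; ring
  rw [e1, e2, Complex.ofReal_sub, Complex.ofReal_cos, Complex.cos]
  push_cast
  ring

theorem integrable_prod_rpow_mul_one_sub_cos {α : ℝ} (h0 : 0 < α) (h2 : α < 2) (V : 𝓢(ℝ, ℂ)) :
    Integrable (fun p : ℝ × ℝ => ((p.2 ^ (-1 - α) * (1 - Real.cos (2 * Real.pi * p.1 * p.2)) : ℝ) : ℂ)
      * 𝓕 (V : ℝ → ℂ) p.1) (volume.prod (volume.restrict (Set.Ioi 0))) := by
  have hc : Continuous (𝓕 (V : ℝ → ℂ)) := (𝓕 V).continuous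
  have hm : Measurable (fun p : ℝ × ℝ =>
      ((p.2 ^ (-1 - α) * (1 - Real.cos (2 * Real.pi * p.1 * p.2)) : ℝ) : ℂ) * 𝓕 (V : ℝ → ℂ) p.1) := by
    have := hc.measurable
    fun_prop
  rw [integrable_prod_iff hm.aestronglyMeasurable]
  constructor
  · refine .of_forall fun η => ?_
    exact (Integrable.ofReal (𝕜 := ℂ)
      (integrableOn_rpow_mul_one_sub_cos h0 h2 (2 * Real.pi * η))).mul_const (𝓕 (V : ℝ → ℂ) η)
  · have hn : ∀ η : ℝ, ∫ t in Set.Ioi (0 : ℝ),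
        ‖((t ^ (-1 - α) * (1 - Real.cos (2 * Real.pi * η * t)) : ℝ) : ℂ) * 𝓕 (V : ℝ → ℂ) η‖
        = fracConst α * ‖((|2 * Real.pi * η| ^ α : ℝ) : ℂ) * 𝓕 (V : ℝ → ℂ) η‖ := by
      intro η
      rw [norm_mul, Complex.norm_real, Real.norm_of_nonneg (by positivity), ← mul_assoc,
        ← integral_rpow_mul_one_sub_cos h0, ← integral_mul_const]
      refine setIntegral_congr_fun measurableSet_Ioi fun t ht => ?_
      simp only [norm_mul, Complex.norm_real]
      rw [Real.norm_of_nonneg (Real.rpow_nonneg (le_of_lt ht) _),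
        Real.norm_of_nonneg (by linarith [Real.cos_le_one (2 * Real.pi * η * t)])]
    simp only [hn]
    exact (integrable_symbol_mul_fourier h0.le V).norm.const_mul _

/-- The singular integral representation of `|D|^α` on Schwartz functions. -/
theorem fracD_eq_integral_second_difference {α : ℝ} (h0 : 0 < α) (h2 : α < 2) (V : 𝓢(ℝ, ℂ)) (x : ℝ) :
    fracD α V x = ((2 * fracConst α)⁻¹ : ℝ) * ∫ t in Set.Ioi (0 : ℝ),
      ((t ^ (-1 - α) : ℝ) : ℂ) * (2 * V x - V (x + t) - V (x - t)) := by
  have hκ := fracConst_pos h0 h2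
  have hI : Integrable (Function.uncurry fun η t : ℝ =>
      Complex.exp (2 * Real.pi * Complex.I * x * η) *
      (((t ^ (-1 - α) * (1 - Real.cos (2 * Real.pi * η * t)) : ℝ) : ℂ) * 𝓕 (V : ℝ → ℂ) η))
      (volume.prod (volume.restrict (Set.Ioi 0))) := by
    refine (integrable_prod_rpow_mul_one_sub_cos h0 h2 V).bdd_mul (c := 1)
      (by fun_prop : Continuous fun p : ℝ × ℝ => Complex.exp (2 * Real.pi * Complex.I * x * p.1)
        ).aestronglyMeasurable (.of_forall fun p => ?_)
    rw [Complex.norm_exp]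
    simp
  have hF := integral_integral_swap hI
  have hL : ∀ η : ℝ, ∫ t in Set.Ioi (0 : ℝ), Complex.exp (2 * Real.pi * Complex.I * x * η) *
      (((t ^ (-1 - α) * (1 - Real.cos (2 * Real.pi * η * t)) : ℝ) : ℂ) * 𝓕 (V : ℝ → ℂ) η)
      = fracConst α * (Complex.exp (2 * Real.pi * Complex.I * x * η) *
        (((|2 * Real.pi * η| ^ α : ℝ) : ℂ) * 𝓕 (V : ℝ → ℂ) η)) := by
    intro η
    rw [integral_const_mul, integral_mul_const, integral_complex_ofReal,
      integral_rpow_mul_one_sub_cos h0]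
    push_cast
    ring
  have hR : ∀ t : ℝ, ∫ η : ℝ, Complex.exp (2 * Real.pi * Complex.I * x * η) *
      (((t ^ (-1 - α) * (1 - Real.cos (2 * Real.pi * η * t)) : ℝ) : ℂ) * 𝓕 (V : ℝ → ℂ) η)
      = (2⁻¹ : ℂ) * (((t ^ (-1 - α) : ℝ) : ℂ) * (2 * V x - V (x + t) - V (x - t))) := by
    intro t
    have := integral_one_sub_cos_mul_fourier V x t
    calc _ = ((t ^ (-1 - α) : ℝ) : ℂ) * ∫ η : ℝ, ((1 - Real.cos (2 * Real.pi * η * t) : ℝ) : ℂ) *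
      (Complex.exp (2 * Real.pi * Complex.I * x * η) * 𝓕 (V : ℝ → ℂ) η) := by
          rw [← integral_const_mul]
          congr 1 with η
          push_cast
          ring
      _ = _ := by rw [this]; ring
  simp only [hL, hR] at hF
  rw [integral_const_mul, integral_const_mul, ← fracD_eq_integral] at hF
  have hκ' : (fracConst α : ℂ) ≠ 0 := by exact_mod_cast hκ.ne'
  rw [eq_comm, ← mul_right_inj' hκ', hF]
  push_cast
  field_simp

theorem exists_integrable_bound_second_difference {α : ℝ} (h0 : 0 < α) (h2 : α < 2) (V : 𝓢(ℝ, ℂ)) :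
    ∃ K : ℝ → ℝ, IntegrableOn K (Set.Ioi 0) ∧ ∀ t, 0 < t → ∀ x,
      t ^ (-1 - α) * ‖2 * V x - V (x + t) - V (x - t)‖ ≤ K t := by
  have hI := (integrable_prod_rpow_mul_one_sub_cos h0 h2 V).norm.integral_prod_right
  refine ⟨_, hI.const_mul 2, fun t ht x => ?_⟩
  have e : 2 * V x - V (x + t) - V (x - t)
    = 2 * ∫ η : ℝ, ((1 - Real.cos (2 * Real.pi * η * t) : ℝ) : ℂ) *
      (Complex.exp (2 * Real.pi * Complex.I * x * η) * 𝓕 (V : ℝ → ℂ) η) := by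
    rw [integral_one_sub_cos_mul_fourier]; ring
  have ht0 : 0 ≤ t ^ (-1 - α) := Real.rpow_nonneg ht.le _
  rw [e, norm_mul, Complex.norm_ofNat, mul_left_comm]
  refine mul_le_mul_of_nonneg_left ?_ zero_le_two
  refine (mul_le_mul_of_nonneg_left (norm_integral_le_integral_norm _) ht0).trans ?_
  rw [← integral_const_mul]
  refine (integral_congr_ae (.of_forall fun η => ?_)).le
  simp only [norm_mul, Complex.norm_real, Complex.norm_exp, Real.norm_of_nonneg ht0]
  simp
  ring

/-- The complexification of a real-valued Schwartz function. -/
noncomputable def SchwartzMap.toComplex (v : 𝓢(ℝ, ℝ)) : 𝓢(ℝ, ℂ) :=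
  SchwartzMap.postcompCLM Complex.ofRealCLM v

theorem SchwartzMap.coe_toComplex (v : 𝓢(ℝ, ℝ)) : ⇑v.toComplex = fun y => (v y : ℂ) := rfl

theorem SchwartzMap.integrable_mul_comp (v : 𝓢(ℝ, ℝ)) {f : ℝ → ℝ} (hf : Continuous f) {w : ℝ → ℝ}
    (hw : Integrable w) : Integrable fun x => v (f x) * w x :=
  hw.bdd_mul (c := SchwartzMap.seminorm ℝ 0 0 v) (v.continuous.comp hf).aestronglyMeasurable
    (.of_forall fun x => SchwartzMap.norm_le_seminorm ℝ v (f x))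

theorem integral_second_difference_mul (v : 𝓢(ℝ, ℝ)) {w : ℝ → ℝ} (hw : Integrable w) (t : ℝ) :
    ∫ x, (2 * v x - v (x + t) - v (x - t)) * w x
      = ∫ x, (v (x + t) - v x) * (w (x + t) - w x) := by
  have hwt : Integrable fun x => w (x + t) := hw.comp_add_right t
  have i1 : Integrable fun x => (v x - v (x + t)) * w x := by
    simp only [sub_mul]
    exact (v.integrable_mul_comp continuous_id hw).sub (v.integrable_mul_comp (by fun_prop) hw)
  have i2 : Integrable fun x => (v x - v (x - t)) * w x := by
    simp only [sub_mul]
    exact (v.integrable_mul_comp continuous_id hw).sub (v.integrable_mul_comp (by fun_prop) hw)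
  have i3 : Integrable fun x => (v (x + t) - v x) * w (x + t) := by
    simpa using i2.comp_add_right t
  have e := integral_add_right_eq_self (μ := volume) (fun x => (v x - v (x - t)) * w x) t
  simp only [add_sub_cancel_right] at e
  calc _ = ∫ x, ((v x - v (x + t)) * w x + (v x - v (x - t)) * w x) := by congr 1 with x; ring
    _ = ∫ x, ((v x - v (x + t)) * w x + (v (x + t) - v x) * w (x + t)) := by
      rw [integral_add i1 i2, integral_add i1 i3, e]
    _ = _ := by congr 1 with x; ring

theorem integral_fracD_mul {α : ℝ} (h0 : 0 < α) (h2 : α < 2) (v : 𝓢(ℝ, ℝ)) {w : ℝ → ℝ}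
    (hw : Integrable w) :
    IntegrableOn (fun t => t ^ (-1 - α) * ∫ x, (v (x + t) - v x) * (w (x + t) - w x)) (Set.Ioi 0) ∧
    ∫ x, fracD α (fun y => (v y : ℂ)) x * (w x : ℂ) = (((2 * fracConst α)⁻¹ *
      ∫ t in Set.Ioi (0 : ℝ), t ^ (-1 - α) * ∫ x, (v (x + t) - v x) * (w (x + t) - w x) : ℝ) : ℂ) := by
  obtain ⟨K, hK, hKb⟩ := exists_integrable_bound_second_difference h0 h2 v.toComplex
  have hI : Integrable (Function.uncurry fun x t : ℝ =>
      t ^ (-1 - α) * ((2 * v x - v (x + t) - v (x - t)) * w x))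
      (volume.prod (volume.restrict (Set.Ioi 0))) := by
    refine (hw.norm.mul_prod hK).mono' ?_ ?_
    · have h1 : AEStronglyMeasurable (fun p : ℝ × ℝ => w p.1)
          (volume.prod (volume.restrict (Set.Ioi 0))) := hw.aestronglyMeasurable.comp_fst
      have h2 : Continuous fun p : ℝ × ℝ => 2 * v p.1 - v (p.1 + p.2) - v (p.1 - p.2) := by
        have := v.continuous
        fun_prop
      exact (by fun_prop : Measurable fun p : ℝ × ℝ => p.2 ^ (-1 - α)).aestronglyMeasurable.mul
        (h2.aestronglyMeasurable.mul h1)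
    · have : ∀ᵐ p : ℝ × ℝ ∂(volume.prod (volume.restrict (Set.Ioi 0))), 0 < p.2 :=
        Measure.quasiMeasurePreserving_snd.ae (ae_restrict_mem measurableSet_Ioi)
      filter_upwards [this] with p hp
      have := hKb p.2 hp p.1
      rw [Function.uncurry_def, norm_mul, norm_mul, Real.norm_of_nonneg (Real.rpow_nonneg hp.le _),
        ← mul_assoc, mul_comm ‖w p.1‖]
      refine mul_le_mul_of_nonneg_right (le_trans (le_of_eq ?_) this) (norm_nonneg _)
      simp only [SchwartzMap.coe_toComplex]
      norm_cast
  have hx : ∀ t, ∫ x, t ^ (-1 - α) * ((2 * v x - v (x + t) - v (x - t)) * w x)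
      = t ^ (-1 - α) * ∫ x, (v (x + t) - v x) * (w (x + t) - w x) := by
    intro t
    rw [integral_const_mul, integral_second_difference_mul v hw]
  constructor
  · have := hI.integral_prod_right
    simp only [Function.uncurry_def, hx] at this
    exact this
  · have hF := integral_integral_swap hI
    simp only [hx] at hF
    rw [← hF, ← integral_const_mul, ← integral_complex_ofReal]
    congr 1 with x
    have := fracD_eq_integral_second_difference h0 h2 v.toComplex x
    simp only [SchwartzMap.coe_toComplex] at this
    rw [this, Complex.ofReal_mul, mul_assoc, ← integral_mul_const, ← integral_complex_ofReal]
    congr 2 with t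
    push_cast
    ring

theorem fracD_two (v : 𝓢(ℝ, ℝ)) (x : ℝ) :
    fracD 2 (fun y => (v y : ℂ)) x = ((-deriv (deriv v) x : ℝ) : ℂ) := by
  set V := v.toComplex
  set W := SchwartzMap.derivCLM ℂ ℂ (SchwartzMap.derivCLM ℂ ℂ V)
  have hd : ∀ U : 𝓢(ℝ, ℂ), ∀ η : ℝ, 𝓕 (SchwartzMap.derivCLM ℂ ℂ U : ℝ → ℂ) η
      = 2 * Real.pi * Complex.I * η * 𝓕 (U : ℝ → ℂ) η := by
    intro U η
    have e : ⇑(SchwartzMap.derivCLM ℂ ℂ U) = deriv U := by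
      ext y; exact SchwartzMap.derivCLM_apply ℂ U y
    rw [e, Real.fourier_deriv U.integrable U.differentiable
      (e ▸ (SchwartzMap.derivCLM ℂ ℂ U).integrable)]
    rfl
  have hW : W x = ((deriv (deriv v) x : ℝ) : ℂ) := by
    have hv : deriv (fun y => (v y : ℂ)) = fun y => ((deriv v y : ℝ) : ℂ) := by
      ext y; exact (v.hasDerivAt y).ofReal_comp.deriv
    have e1 : ⇑(SchwartzMap.derivCLM ℂ ℂ V) = fun y => ((deriv v y : ℝ) : ℂ) := by
      ext y
      rw [SchwartzMap.derivCLM_apply, SchwartzMap.coe_toComplex, hv]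
    rw [SchwartzMap.derivCLM_apply, e1]
    have h := (SchwartzMap.derivCLM ℝ ℝ v).hasDerivAt x
    have e2 : ⇑(SchwartzMap.derivCLM ℝ ℝ v) = deriv v := by
      ext y; exact SchwartzMap.derivCLM_apply ℝ v y
    rw [e2] at h
    exact h.ofReal_comp.deriv
  rw [Complex.ofReal_neg, ← hW, ← integral_exp_mul_fourier W x, ← integral_neg, fracD_eq_integral]
  congr 1 with η
  rw [hd, hd]
  have : ((|2 * Real.pi * η| ^ (2 : ℝ) : ℝ) : ℂ) = (2 * Real.pi * η) ^ 2 := by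
    rw [Real.rpow_two, sq_abs]; push_cast; ring
  rw [this]
  simp only [V, SchwartzMap.coe_toComplex]
  linear_combination (Complex.exp (2 * Real.pi * Complex.I * x * η) * (2 * Real.pi * η) ^ 2 *
    𝓕 (fun y => (v y : ℂ)) η) * Complex.I_sq

theorem one_le_jap (x : ℝ) : 1 ≤ jap x := Real.one_le_sqrt.2 (by nlinarith)

theorem jap_pos (x : ℝ) : 0 < jap x := zero_lt_one.trans_le (one_le_jap x)

theorem jap_rpow_pos (x a : ℝ) : 0 < jap x ^ a := Real.rpow_pos_of_pos (jap_pos x) a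

theorem jap_sq (x : ℝ) : jap x ^ 2 = 1 + x ^ 2 := Real.sq_sqrt (by positivity)

theorem jap_rpow_neg (x a : ℝ) : jap x ^ (-a) = (1 + x ^ 2) ^ (-a / 2) := by
  rw [jap, Real.sqrt_eq_rpow, ← Real.rpow_mul (by positivity)]
  congr 1
  ring

theorem continuous_jap_rpow (a : ℝ) : Continuous fun x => jap x ^ a := by
  have : Continuous jap := by unfold jap; fun_prop
  exact this.rpow_const fun x => Or.inl (jap_pos x).ne'

theorem jap_rpow_neg_le_one {a : ℝ} (ha : 0 ≤ a) (x : ℝ) : jap x ^ (-a) ≤ 1 :=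
  Real.rpow_le_one_of_one_le_of_nonpos (one_le_jap x) (by linarith)

theorem jap_rpow_neg_le_mul {a c : ℝ} (ha : 0 ≤ a) (hc : 0 < c) {x y : ℝ} (h : jap x ≤ c * jap y) :
    jap y ^ (-a) ≤ c ^ a * jap x ^ (-a) := by
  have := Real.rpow_le_rpow_of_nonpos (jap_pos x) h (by linarith : -a ≤ 0)
  rw [Real.mul_rpow hc.le (jap_pos y).le, Real.rpow_neg hc.le] at this
  have hca : 0 < c ^ a := Real.rpow_pos_of_pos hc a
  calc jap y ^ (-a) = c ^ a * ((c ^ a)⁻¹ * jap y ^ (-a)) := by field_simp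
    _ ≤ _ := mul_le_mul_of_nonneg_left this hca.le

theorem jap_le_two_mul_of_abs_sub_le_one {x y : ℝ} (h : |y - x| ≤ 1) : jap x ≤ 2 * jap y := by
  refine le_of_sq_le_sq ?_ (by linarith [jap_pos y])
  rw [mul_pow, jap_sq, jap_sq]
  nlinarith [sq_nonneg (x - 2 * y), abs_le.1 h, sq_abs (y - x), abs_nonneg (y - x)]

theorem jap_rpow_neg_le_of_abs_sub_le_one {a : ℝ} (ha : 0 ≤ a) {x y : ℝ} (h : |y - x| ≤ 1) :
    jap y ^ (-a) ≤ 2 ^ a * jap x ^ (-a) :=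
  jap_rpow_neg_le_mul ha two_pos (jap_le_two_mul_of_abs_sub_le_one h)

theorem hasDerivAt_one_add_sq_rpow (p x : ℝ) :
    HasDerivAt (fun y : ℝ => (1 + y ^ 2) ^ p) (2 * p * x * (1 + x ^ 2) ^ (p - 1)) x := by
  have h : HasDerivAt (fun y : ℝ => 1 + y ^ 2) (2 * x) x := by
    simpa using (hasDerivAt_pow 2 x).const_add 1
  convert h.rpow_const (p := p) (Or.inl (by positivity)) using 1
  ring

/-- The derivative of `⟨x⟩^{-a}`. -/
noncomputable def japDeriv (a x : ℝ) : ℝ := -a * x * (1 + x ^ 2) ^ (-a / 2 - 1)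

theorem hasDerivAt_jap_rpow (a x : ℝ) : HasDerivAt (fun y => jap y ^ (-a)) (japDeriv a x) x := by
  simp only [jap_rpow_neg]
  convert hasDerivAt_one_add_sq_rpow (-a / 2) x using 1
  rw [japDeriv]
  ring

theorem continuous_japDeriv (a : ℝ) : Continuous (japDeriv a) := by
  unfold japDeriv
  have : Continuous fun x : ℝ => (1 + x ^ 2) ^ (-a / 2 - 1) :=
    (by fun_prop : Continuous fun x : ℝ => 1 + x ^ 2).rpow_const fun x => Or.inl (by positivity)
  fun_prop

theorem abs_mul_one_add_sq_rpow_le (p x : ℝ) :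
    |x| * (1 + x ^ 2) ^ (p - 1) ≤ (1 + x ^ 2) ^ p := by
  have h : 0 < (1 + x ^ 2) ^ (p - 1) := by positivity
  calc _ ≤ (1 + x ^ 2) * (1 + x ^ 2) ^ (p - 1) := by
        refine mul_le_mul_of_nonneg_right ?_ h.le
        nlinarith [sq_abs x, sq_nonneg (|x| - 1)]
    _ = _ := by rw [Real.rpow_sub_one (by positivity)]; field_simp

theorem abs_japDeriv_le {a : ℝ} (ha : 0 ≤ a) (x : ℝ) : |japDeriv a x| ≤ a * jap x ^ (-a) := by
  rw [jap_rpow_neg, japDeriv, abs_mul, abs_mul, abs_neg, abs_of_nonneg ha, mul_assoc,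
    abs_of_pos (by positivity : 0 < (1 + x ^ 2) ^ (-a / 2 - 1))]
  exact mul_le_mul_of_nonneg_left (abs_mul_one_add_sq_rpow_le _ x) ha

theorem exists_hasDerivAt_japDeriv {a : ℝ} (ha : 0 ≤ a) (x : ℝ) :
    ∃ d, HasDerivAt (japDeriv a) d x ∧ |d| ≤ (a + a * (a + 2)) * jap x ^ (-a) := by
  have h1 := hasDerivAt_one_add_sq_rpow (-a / 2 - 1) x
  have h2 : HasDerivAt (fun y : ℝ => -a * y) (-a) x := by
    simpa using (hasDerivAt_id x).const_mul (-a)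
  refine ⟨_, h2.mul h1, ?_⟩
  set P := (1 + x ^ 2) ^ (-a / 2) with hP
  have hP0 : 0 < P := by positivity
  have e1 : (1 + x ^ 2) ^ (-a / 2 - 1) = P / (1 + x ^ 2) := Real.rpow_sub_one (by positivity) _
  have e2 : (1 + x ^ 2) ^ (-a / 2 - 1 - 1) = P / (1 + x ^ 2) / (1 + x ^ 2) := by
    rw [Real.rpow_sub_one (by positivity), e1]
  rw [jap_rpow_neg, ← hP, e1, e2]
  have hD : 0 < 1 + x ^ 2 := by positivity
  have e3 : -a * (P / (1 + x ^ 2)) + -a * x * (2 * (-a / 2 - 1) * x * (P / (1 + x ^ 2) / (1 + x ^ 2)))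
      = P * (a * (-1 + (a + 2) * (x ^ 2 / (1 + x ^ 2))) / (1 + x ^ 2)) := by
    field_simp
    ring
  rw [e3, abs_mul, abs_of_pos hP0, mul_comm]
  refine mul_le_mul_of_nonneg_right ?_ hP0.le
  have q0 : 0 ≤ x ^ 2 / (1 + x ^ 2) := by positivity
  have q1 : x ^ 2 / (1 + x ^ 2) ≤ 1 := by rw [div_le_one hD]; linarith
  rw [abs_div, abs_of_pos hD, div_le_iff₀ hD, abs_mul, abs_of_nonneg ha]
  have : |-1 + (a + 2) * (x ^ 2 / (1 + x ^ 2))| ≤ 1 + (a + 2) := by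
    rw [abs_le]; constructor <;> nlinarith
  calc _ ≤ a * (1 + (a + 2)) := mul_le_mul_of_nonneg_left this ha
    _ ≤ (a + a * (a + 2)) * (1 + x ^ 2) := by nlinarith [mul_nonneg ha (sq_nonneg x), mul_nonneg (mul_nonneg ha ha) (sq_nonneg x)]

theorem abs_sub_sub_mul_deriv_le {f f' : ℝ → ℝ} {x s K : ℝ} (hf : ∀ y, HasDerivAt f (f' y) y)
    (hf' : ∀ y, |y - x| ≤ |s| → ∃ d, HasDerivAt f' d y ∧ |d| ≤ K) :
    |f (x + s) - f x - s * f' x| ≤ K * s ^ 2 := by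
  have hx : x ∈ Metric.closedBall x |s| := Metric.mem_closedBall_self (abs_nonneg s)
  have hxs : x + s ∈ Metric.closedBall x |s| := by simp
  choose! d hd hdK using hf'
  have h1 : ∀ y ∈ Metric.closedBall x |s|, |f' y - f' x| ≤ K * |s| := by
    intro y hy
    have h := (convex_closedBall x |s|).norm_image_sub_le_of_norm_hasDerivWithin_le
      (f := f') (f' := d) (C := K) (fun z hz => (hd z (by simpa [Real.dist_eq] using hz)).hasDerivWithinAt)
      (fun z hz => hdK z (by simpa [Real.dist_eq] using hz)) hx hy
    have hK : 0 ≤ K := (abs_nonneg _).trans (hdK x (by simp))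
    exact h.trans (mul_le_mul_of_nonneg_left (by simpa [Real.dist_eq] using hy) hK)
  have h := (convex_closedBall x |s|).norm_image_sub_le_of_norm_hasDerivWithin_le
      (f := fun y => f y - y * f' x) (f' := fun y => f' y - f' x) (C := K * |s|)
      (fun z hz => by
        have := (hf z).sub ((hasDerivAt_id z).mul_const (f' x))
        rw [one_mul] at this
        exact HasDerivAt.hasDerivWithinAt this)
      (fun z hz => h1 z hz) hx hxs
  rw [Real.norm_eq_abs, Real.norm_eq_abs, add_sub_cancel_left, mul_assoc, ← sq, sq_abs] at h
  calc _ = |f (x + s) - (x + s) * f' x - (f x - x * f' x)| := by congr 1; ring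
    _ ≤ _ := h

theorem exists_jap_rpow_taylor {a : ℝ} (ha : 0 ≤ a) : ∃ C, 0 ≤ C ∧ ∀ x s, |s| ≤ 1 →
    |jap (x + s) ^ (-a) - jap x ^ (-a) - s * japDeriv a x| ≤ C * jap x ^ (-a) * s ^ 2 := by
  refine ⟨(a + a * (a + 2)) * 2 ^ a, by positivity, fun x s hs => ?_⟩
  refine abs_sub_sub_mul_deriv_le (hasDerivAt_jap_rpow a) fun y hy => ?_
  obtain ⟨d, hd, hdb⟩ := exists_hasDerivAt_japDeriv ha y
  refine ⟨d, hd, hdb.trans ?_⟩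
  rw [mul_assoc]
  exact mul_le_mul_of_nonneg_left (jap_rpow_neg_le_of_abs_sub_le_one ha (hy.trans hs)) (by positivity)

theorem integrable_jap_rpow_neg {a : ℝ} (ha : 1 < a) : Integrable fun x => jap x ^ (-a) := by
  have := integrable_rpow_neg_one_add_norm_sq (E := ℝ) (μ := volume) (r := a) (by simpa using ha)
  simpa [jap_rpow_neg] using this

/-- The weight `∫_{-∞}^x ⟨s⟩^{-a} ds`. -/
noncomputable def japPrimitive (a x : ℝ) : ℝ := ∫ s in Set.Iic x, jap s ^ (-a)

theorem japPrimitive_sub {a : ℝ} (ha : 1 < a) (x y : ℝ) :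
    japPrimitive a y - japPrimitive a x = ∫ s in x..y, jap s ^ (-a) :=
  intervalIntegral.integral_Iic_sub_Iic (integrable_jap_rpow_neg ha).integrableOn
    (integrable_jap_rpow_neg ha).integrableOn

theorem hasDerivAt_japPrimitive {a : ℝ} (ha : 1 < a) (x : ℝ) :
    HasDerivAt (japPrimitive a) (jap x ^ (-a)) x := by
  have e : japPrimitive a = fun y => japPrimitive a 0 + ∫ s in (0 : ℝ)..y, jap s ^ (-a) := by
    ext y; rw [← japPrimitive_sub ha]; ring
  rw [e]
  exact ((continuous_jap_rpow (-a)).integral_hasStrictDerivAt 0 x).hasDerivAt.const_add _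

theorem continuous_japPrimitive {a : ℝ} (ha : 1 < a) : Continuous (japPrimitive a) :=
  continuous_iff_continuousAt.2 fun x => (hasDerivAt_japPrimitive ha x).continuousAt

theorem japPrimitive_mono {a : ℝ} (ha : 1 < a) : Monotone (japPrimitive a) := by
  intro x y hxy
  rw [← sub_nonneg, japPrimitive_sub ha]
  exact intervalIntegral.integral_nonneg hxy fun s _ => (jap_rpow_pos s _).le

theorem abs_japPrimitive_le {a : ℝ} (ha : 1 < a) (x : ℝ) :
    |japPrimitive a x| ≤ ∫ s, jap s ^ (-a) := by
  rw [japPrimitive, abs_of_nonneg (setIntegral_nonneg measurableSet_Iic fun s _ => (jap_rpow_pos s _).le)]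
  exact setIntegral_le_integral (integrable_jap_rpow_neg ha) (.of_forall fun s => (jap_rpow_pos s _).le)

theorem abs_japPrimitive_sub_le {a : ℝ} (ha : 1 < a) (x y : ℝ) :
    |japPrimitive a y - japPrimitive a x| ≤ |y - x| := by
  rw [japPrimitive_sub ha]
  have := intervalIntegral.norm_integral_le_of_norm_le_const (a := x) (b := y) (C := 1)
    (f := fun s => jap s ^ (-a)) fun s _ => by
      rw [Real.norm_of_nonneg (jap_rpow_pos s _).le]
      exact jap_rpow_neg_le_one (by linarith) s
  simpa using this

/-- A one-sided error estimate for the trapezoidal rule. -/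
theorem exists_japPrimitive_trapezoid {a : ℝ} (ha : 1 < a) : ∃ C, 0 ≤ C ∧ ∀ x t, 0 ≤ t → t ≤ 1 →
    t * ((jap x ^ (-a) + jap (x + t) ^ (-a)) / 2) - C * jap x ^ (-a) * t ^ 3
      ≤ japPrimitive a (x + t) - japPrimitive a x := by
  obtain ⟨C, hC, h⟩ := exists_jap_rpow_taylor (a := a) (by linarith)
  refine ⟨2 * C, by positivity, fun x t ht ht1 => ?_⟩
  have e : japPrimitive a (x + t) - japPrimitive a x = ∫ s in (0 : ℝ)..t, jap (x + s) ^ (-a) := by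
    rw [japPrimitive_sub ha, intervalIntegral.integral_comp_add_left (fun s => jap s ^ (-a)), add_zero]
  set g := jap x ^ (-a)
  have hg : 0 < g := jap_rpow_pos x _
  set d := japDeriv a x
  have hlow : ∫ s in (0 : ℝ)..t, (g + s * d - C * g * t ^ 2)
      ≤ ∫ s in (0 : ℝ)..t, jap (x + s) ^ (-a) := by
    refine intervalIntegral.integral_mono_on ht
      ((by fun_prop : Continuous fun s : ℝ => g + s * d - C * g * t ^ 2).intervalIntegrable _ _)
      (((continuous_jap_rpow (-a)).comp (by fun_prop)).intervalIntegrable _ _) fun s hs => ?_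
    have h1 := (abs_le.1 (h x s (by rw [abs_of_nonneg hs.1]; exact hs.2.trans ht1))).1
    have h2 : s ^ 2 ≤ t ^ 2 := by nlinarith [hs.1, hs.2]
    have h3 := mul_le_mul_of_nonneg_left h2 (mul_nonneg hC hg.le)
    linarith
  have hval : ∫ s in (0 : ℝ)..t, (g + s * d - C * g * t ^ 2) = t * g + t ^ 2 / 2 * d - C * g * t ^ 3 := by
    have hc {f : ℝ → ℝ} (hf : Continuous f) : IntervalIntegrable f volume 0 t :=
      hf.intervalIntegrable _ _
    rw [intervalIntegral.integral_sub (hc (by fun_prop)) (hc (by fun_prop)),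
      intervalIntegral.integral_add (hc (by fun_prop)) (hc (by fun_prop)),
      intervalIntegral.integral_mul_const]
    simp only [intervalIntegral.integral_const, integral_id, smul_eq_mul]
    ring
  have hup := (abs_le.1 (h x t (by rwa [abs_of_nonneg ht]))).2
  rw [e]
  have := mul_le_mul_of_nonneg_left hup (by linarith : 0 ≤ t / 2)
  nlinarith [mul_nonneg (mul_nonneg hC hg.le) (pow_nonneg ht 3)]

theorem exists_rpow_mul_jap_rpow_le {a b : ℝ} (ha : 0 ≤ a) (hab : a ≤ b) : ∃ C, 0 ≤ C ∧
    ∀ x y t, 1 ≤ t → |y - x| = t →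
      t ^ (-b) * jap y ^ (-a) ≤ C * (jap x ^ (-a) * (t ^ (-b) + jap y ^ (-a))) := by
  refine ⟨4 ^ a + 4 ^ b, by positivity, fun x y t ht hxy => ?_⟩
  have hjx := jap_rpow_pos x (-a)
  have hjy := jap_rpow_pos y (-a)
  have htb : 0 < t ^ (-b) := Real.rpow_pos_of_pos (by linarith) _
  have ht0 : 0 < t := by linarith
  have h4a : (0 : ℝ) < 4 ^ a := by positivity
  have h4b : (0 : ℝ) < 4 ^ b := by positivity
  by_cases h : jap x ≤ 4 * jap y
  · have h1 := jap_rpow_neg_le_mul ha (by norm_num) h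
    have : t ^ (-b) * jap y ^ (-a) ≤ 4 ^ a * jap x ^ (-a) * t ^ (-b) := by
      rw [mul_comm]; exact mul_le_mul_of_nonneg_right h1 htb.le
    have e1 : 0 ≤ 4 ^ b * (jap x ^ (-a) * (t ^ (-b) + jap y ^ (-a))) := by positivity
    have e2 : 0 ≤ 4 ^ a * (jap x ^ (-a) * jap y ^ (-a)) := by positivity
    nlinarith
  · have hle : jap x ≤ 4 * t := by
      by_contra! hlt
      refine h (le_of_sq_le_sq ?_ (by linarith [jap_pos y]))
      have h2 := jap_sq x
      have h3 := jap_sq y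
      have h4 : 16 * t ^ 2 ≤ jap x ^ 2 := by nlinarith [jap_pos x]
      have h5 : (y - x) ^ 2 = t ^ 2 := by rw [← hxy, sq_abs]
      nlinarith [sq_nonneg (x - 2 * y), sq_nonneg (2 * x - y)]
    have h1 : t ^ (-b) ≤ 4 ^ b * jap x ^ (-b) := by
      have := Real.rpow_le_rpow_of_nonpos (jap_pos x) hle (by linarith : -b ≤ 0)
      rw [Real.mul_rpow (by norm_num) ht0.le, Real.rpow_neg (by norm_num)] at this
      calc t ^ (-b) = 4 ^ b * ((4 ^ b)⁻¹ * t ^ (-b)) := by field_simp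
        _ ≤ _ := mul_le_mul_of_nonneg_left this h4b.le
    have h2 : jap x ^ (-b) ≤ jap x ^ (-a) :=
      Real.rpow_le_rpow_of_exponent_le (one_le_jap x) (by linarith)
    have h3 : t ^ (-b) * jap y ^ (-a) ≤ 4 ^ b * jap x ^ (-a) * jap y ^ (-a) :=
      mul_le_mul_of_nonneg_right (h1.trans (mul_le_mul_of_nonneg_left h2 h4b.le)) hjy.le
    have e1 : 0 ≤ 4 ^ a * (jap x ^ (-a) * (t ^ (-b) + jap y ^ (-a))) := by positivity
    have e2 : 0 ≤ 4 ^ b * (jap x ^ (-a) * t ^ (-b)) := by positivity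
    nlinarith

theorem hasTemperateGrowth_jap_rpow (a : ℝ) : (fun x => jap x ^ (-a)).HasTemperateGrowth := by
  have := Function.hasTemperateGrowth_one_add_norm_sq_rpow ℝ (-a / 2)
  simpa [jap_rpow_neg] using this

/-- Multiplication of a Schwartz function by `⟨x⟩^{-a}`. -/
noncomputable def SchwartzMap.japMul (a : ℝ) (u : 𝓢(ℝ, ℝ)) : 𝓢(ℝ, ℝ) :=
  SchwartzMap.smulLeftCLM ℝ (fun x => jap x ^ (-a)) u

theorem SchwartzMap.japMul_apply (a : ℝ) (u : 𝓢(ℝ, ℝ)) (x : ℝ) :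
    u.japMul a x = jap x ^ (-a) * u x :=
  SchwartzMap.smulLeftCLM_apply_apply (hasTemperateGrowth_jap_rpow a) u x

theorem SchwartzMap.exists_abs_le (u : 𝓢(ℝ, ℝ)) :
    ∃ A, 0 ≤ A ∧ ∀ x, |u x| ≤ A * jap x ^ (-2 : ℝ) := by
  obtain ⟨A, hA⟩ := u.decay 0 0
  obtain ⟨B, hB⟩ := u.decay 2 0
  simp only [pow_zero, one_mul, norm_iteratedFDeriv_zero, Real.norm_eq_abs, sq_abs] at hA hB
  have hbd x : |u x| ≤ (A + B) * jap x ^ (-2 : ℝ) := by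
    rw [Real.rpow_neg (jap_pos x).le, Real.rpow_two, jap_sq, ← div_eq_mul_inv,
      le_div_iff₀ (by positivity)]
    linarith [hA.2 x, hB.2 x]
  exact ⟨A + B, by linarith [hA.1, hB.1], hbd⟩

/-- An integrable majorant for the functions `x ↦ f x` and `x ↦ f (x + t)` with `f` Schwartz. -/
noncomputable def japSum (t x : ℝ) : ℝ := jap x ^ (-2 : ℝ) + jap (x + t) ^ (-2 : ℝ)

theorem japSum_pos (t x : ℝ) : 0 < japSum t x :=
  add_pos (jap_rpow_pos _ _) (jap_rpow_pos _ _)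

theorem japSum_le_two (t x : ℝ) : japSum t x ≤ 2 := by
  have h1 := jap_rpow_neg_le_one zero_le_two x
  have h2 := jap_rpow_neg_le_one zero_le_two (x + t)
  rw [japSum]; linarith

theorem integrable_japSum (t : ℝ) : Integrable (japSum t) :=
  (integrable_jap_rpow_neg one_lt_two).add ((integrable_jap_rpow_neg one_lt_two).comp_add_right t)

theorem integral_japSum (t : ℝ) : ∫ x, japSum t x = 2 * ∫ x, jap x ^ (-2 : ℝ) := by
  have h := integrable_jap_rpow_neg one_lt_two
  unfold japSum
  rw [integral_add h (h.comp_add_right t), integral_add_right_eq_self (fun x => jap x ^ (-2 : ℝ))]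
  ring

theorem integrable_of_abs_le_japSum {f : ℝ → ℝ} (hf : Continuous f) {K t : ℝ}
    (h : ∀ x, |f x| ≤ K * japSum t x) : Integrable f :=
  ((integrable_japSum t).const_mul K).mono' hf.aestronglyMeasurable (.of_forall h)

theorem abs_integral_le_of_abs_le_japSum {f : ℝ → ℝ} {K t : ℝ}
    (h : ∀ x, |f x| ≤ K * japSum t x) : |∫ x, f x| ≤ K * (2 * ∫ x, jap x ^ (-2 : ℝ)) := by
  rw [← integral_japSum t, ← integral_const_mul]
  exact norm_integral_le_of_norm_le (f := f) ((integrable_japSum t).const_mul K) (.of_forall h)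

theorem SchwartzMap.exists_abs_deriv_le (u : 𝓢(ℝ, ℝ)) :
    ∃ A, 0 ≤ A ∧ ∀ x, |deriv u x| ≤ A * jap x ^ (-2 : ℝ) :=
  (SchwartzMap.derivCLM ℝ ℝ u).exists_abs_le

theorem SchwartzMap.continuous_deriv (u : 𝓢(ℝ, ℝ)) : Continuous (deriv u) :=
  (SchwartzMap.derivCLM ℝ ℝ u).continuous

/-- Pointwise control of the increments of a Schwartz function. -/
theorem SchwartzMap.exists_abs_sub_le (u : 𝓢(ℝ, ℝ)) : ∃ A, 0 ≤ A ∧ ∀ x t, 0 ≤ t →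
    |u (x + t) - u x| ≤ A * (min t 1 * japSum t x) := by
  obtain ⟨A, hA, hu⟩ := u.exists_abs_le
  obtain ⟨B, hB, hu'⟩ := u.exists_abs_deriv_le
  refine ⟨A + B * 2 ^ (2 : ℝ), by positivity, fun x t ht => ?_⟩
  have hx := jap_rpow_pos x (-2)
  have hxt := jap_rpow_pos (x + t) (-2)
  have hB4 : 0 ≤ B * 2 ^ (2 : ℝ) := by positivity
  have hS := japSum_pos t x
  rcases le_total t 1 with h1 | h1
  · rw [min_eq_left h1]
    have h := (convex_Icc x (x + t)).norm_image_sub_le_of_norm_hasDerivWithin_le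
      (f := u) (f' := deriv u) (C := B * (2 ^ (2 : ℝ) * jap x ^ (-2 : ℝ)))
      (fun z _ => (u.hasDerivAt z).hasDerivWithinAt)
      (fun z hz => (hu' z).trans (mul_le_mul_of_nonneg_left
        (jap_rpow_neg_le_of_abs_sub_le_one zero_le_two
          (by rw [abs_of_nonneg] <;> linarith [hz.1, hz.2])) hB))
      (Set.left_mem_Icc.2 (by linarith)) (Set.right_mem_Icc.2 (by linarith))
    rw [Real.norm_eq_abs, Real.norm_eq_abs, add_sub_cancel_left, abs_of_nonneg ht] at h
    refine h.trans ?_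
    have e : t * jap x ^ (-2 : ℝ) ≤ t * japSum t x :=
      mul_le_mul_of_nonneg_left (by rw [japSum]; linarith) ht
    have e1 := mul_le_mul_of_nonneg_left e hB4
    have e2 : 0 ≤ A * (t * japSum t x) := by positivity
    linarith
  · rw [min_eq_right h1, one_mul]
    have h2 := hu x
    have h3 := hu (x + t)
    have e : 0 ≤ B * 2 ^ (2 : ℝ) * japSum t x := by positivity
    calc _ ≤ |u (x + t)| + |u x| := abs_sub _ _
      _ ≤ A * japSum t x := by rw [japSum]; linarith
      _ ≤ _ := by linarith

theorem exists_abs_japPrimitive_sub_le {a : ℝ} (ha : 1 < a) : ∃ D, 0 ≤ D ∧ ∀ x t, 0 ≤ t →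
    |japPrimitive a (x + t) - japPrimitive a x| ≤ D * min t 1 := by
  set I := ∫ s, jap s ^ (-a) with hI
  have hI0 : 0 ≤ I := integral_nonneg fun s => (jap_rpow_pos s _).le
  refine ⟨1 + 2 * I, by positivity, fun x t ht => ?_⟩
  rcases le_total t 1 with h1 | h1
  · rw [min_eq_left h1]
    have := abs_japPrimitive_sub_le ha x (x + t)
    rw [add_sub_cancel_left, abs_of_nonneg ht] at this
    nlinarith
  · rw [min_eq_right h1]
    have h2 := abs_japPrimitive_le ha x
    have h3 := abs_japPrimitive_le ha (x + t)
    linarith [abs_sub (japPrimitive a (x + t)) (japPrimitive a x)]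

namespace SchwartzMap

variable (u : 𝓢(ℝ, ℝ)) (a : ℝ)

/-- The integrand of `incrEnergy`. -/
noncomputable def incrDensity (t x : ℝ) : ℝ :=
  1 / 2 * (u (x + t) - u x) ^ 2 * (japPrimitive a (x + t) - japPrimitive a x)

/-- The derivative of `incrDensity` in `t`. -/
noncomputable def incrDensityDeriv (t x : ℝ) : ℝ :=
  (u (x + t) - u x) * deriv u (x + t) * (japPrimitive a (x + t) - japPrimitive a x)
    + 1 / 2 * (u (x + t) - u x) ^ 2 * jap (x + t) ^ (-a)

/-- The integrand of `symmEnergy`. -/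
noncomputable def symmDensity (t x : ℝ) : ℝ :=
  1 / 2 * (u (x + t) - u x) ^ 2 * (jap (x + t) ^ (-a) + jap x ^ (-a))

/-- The energy of the increments of `u`, weighted by the increments of `japPrimitive a`. -/
noncomputable def incrEnergy (t : ℝ) : ℝ := ∫ x, u.incrDensity a t x

/-- The energy of the increments of `u`, weighted by the mean of `⟨·⟩^{-a}` at the endpoints. -/
noncomputable def symmEnergy (t : ℝ) : ℝ := ∫ x, u.symmDensity a t x

variable {a}

theorem exists_abs_incrDensity_le (ha : 1 < a) : ∃ K, 0 ≤ K ∧ ∀ t x, 0 ≤ t →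
    |u.incrDensity a t x| ≤ K * (min t 1) ^ 3 * japSum t x := by
  obtain ⟨A, hA, hu⟩ := u.exists_abs_sub_le
  obtain ⟨D, hD, hφ⟩ := exists_abs_japPrimitive_sub_le ha
  refine ⟨A ^ 2 * D, by positivity, fun t x ht => ?_⟩
  have hm : 0 ≤ min t 1 := le_min ht zero_le_one
  have hS := japSum_pos t x
  have hS2 := japSum_le_two t x
  rw [incrDensity, abs_mul, abs_mul, abs_pow, abs_of_pos (by norm_num : (0 : ℝ) < 1 / 2)]
  calc _ ≤ 1 / 2 * (A * (min t 1 * japSum t x)) ^ 2 * (D * min t 1) := by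
        gcongr
        exacts [hu x t ht, hφ x t ht]
    _ = A ^ 2 * D * (min t 1) ^ 3 * japSum t x * (japSum t x / 2) := by ring
    _ ≤ _ := mul_le_of_le_one_right (by positivity) (by linarith)

theorem abs_half_sq_mul_le {A m S d : ℝ} (hS : 0 ≤ S) (hS2 : S ≤ 2)
    (h : |d| ≤ A * (m * S)) : |1 / 2 * d ^ 2| ≤ A ^ 2 * m ^ 2 * S := by
  rw [abs_mul, abs_pow, abs_of_pos (by norm_num : (0 : ℝ) < 1 / 2)]
  calc _ ≤ 1 / 2 * (A * (m * S)) ^ 2 := by gcongr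
    _ = A ^ 2 * m ^ 2 * S * (S / 2) := by ring
    _ ≤ _ := mul_le_of_le_one_right (by positivity) (by linarith)

theorem exists_abs_incrDensityDeriv_le (ha : 1 < a) : ∃ K, 0 ≤ K ∧ ∀ t x, 0 ≤ t →
    |u.incrDensityDeriv a t x| ≤ K * (min t 1) ^ 2 * japSum t x := by
  obtain ⟨A, hA, hu⟩ := u.exists_abs_sub_le
  obtain ⟨B, hB, hu'⟩ := u.exists_abs_deriv_le
  obtain ⟨D, hD, hφ⟩ := exists_abs_japPrimitive_sub_le ha
  refine ⟨A * B * D + A ^ 2, by positivity, fun t x ht => ?_⟩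
  have hm : 0 ≤ min t 1 := le_min ht zero_le_one
  have hS := japSum_pos t x
  have hub : |deriv u (x + t)| ≤ B :=
    (hu' _).trans (mul_le_of_le_one_right hB (jap_rpow_neg_le_one zero_le_two _))
  have h1 : |(u (x + t) - u x) * deriv u (x + t) * (japPrimitive a (x + t) - japPrimitive a x)|
      ≤ A * (min t 1 * japSum t x) * B * (D * min t 1) := by
    rw [abs_mul, abs_mul]
    gcongr
    exacts [hu x t ht, hφ x t ht]
  have h2 : |1 / 2 * (u (x + t) - u x) ^ 2 * jap (x + t) ^ (-a)|
      ≤ A ^ 2 * (min t 1) ^ 2 * japSum t x := by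
    rw [abs_mul, abs_of_pos (jap_rpow_pos (x + t) (-a))]
    exact (mul_le_of_le_one_right (abs_nonneg _) (jap_rpow_neg_le_one (by linarith) _)).trans
      (abs_half_sq_mul_le hS.le (japSum_le_two t x) (hu x t ht))
  rw [incrDensityDeriv]
  refine (abs_add_le _ _).trans ((add_le_add h1 h2).trans_eq ?_)
  ring

theorem exists_abs_symmDensity_le (ha : 1 < a) : ∃ K, 0 ≤ K ∧ ∀ t x, 0 ≤ t →
    |u.symmDensity a t x| ≤ K * (min t 1) ^ 2 * japSum t x := by
  obtain ⟨A, hA, hu⟩ := u.exists_abs_sub_le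
  refine ⟨2 * A ^ 2, by positivity, fun t x ht => ?_⟩
  have h1 := abs_half_sq_mul_le (japSum_pos t x).le (japSum_le_two t x) (hu x t ht)
  have h2 := jap_rpow_neg_le_one (by linarith : 0 ≤ a) x
  have h3 := jap_rpow_neg_le_one (by linarith : 0 ≤ a) (x + t)
  have h4 := jap_rpow_pos x (-a)
  have h5 := jap_rpow_pos (x + t) (-a)
  rw [symmDensity, abs_mul, abs_of_pos (add_pos h5 h4)]
  calc _ ≤ A ^ 2 * (min t 1) ^ 2 * japSum t x * 2 :=
        mul_le_mul h1 (by linarith) (by positivity) ((abs_nonneg _).trans h1)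
    _ = _ := by ring

theorem continuous_incrDensity (ha : 1 < a) :
    Continuous fun p : ℝ × ℝ => u.incrDensity a p.1 p.2 := by
  have := continuous_japPrimitive ha
  unfold incrDensity
  fun_prop

theorem continuous_incrDensityDeriv (ha : 1 < a) :
    Continuous fun p : ℝ × ℝ => u.incrDensityDeriv a p.1 p.2 := by
  have := continuous_japPrimitive ha
  have := u.continuous_deriv
  have := continuous_jap_rpow (-a)
  have h2 : Continuous fun p : ℝ × ℝ => jap (p.2 + p.1) ^ (-a) := this.comp (by fun_prop)
  unfold incrDensityDeriv
  fun_prop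

theorem continuous_symmDensity (a : ℝ) :
    Continuous fun p : ℝ × ℝ => u.symmDensity a p.1 p.2 := by
  have := continuous_jap_rpow (-a)
  have h1 : Continuous fun p : ℝ × ℝ => jap (p.2 + p.1) ^ (-a) := this.comp (by fun_prop)
  have h2 : Continuous fun p : ℝ × ℝ => jap p.2 ^ (-a) := this.comp (by fun_prop)
  unfold symmDensity
  fun_prop

theorem integrable_incrDensity (ha : 1 < a) {t : ℝ} (ht : 0 ≤ t) :
    Integrable (u.incrDensity a t) := by
  obtain ⟨K, -, hK⟩ := u.exists_abs_incrDensity_le ha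
  exact integrable_of_abs_le_japSum
    ((u.continuous_incrDensity ha).comp (by fun_prop : Continuous fun x : ℝ => (t, x)))
    fun x => hK t x ht

theorem integrable_incrDensityDeriv (ha : 1 < a) {t : ℝ} (ht : 0 ≤ t) :
    Integrable (u.incrDensityDeriv a t) := by
  obtain ⟨K, -, hK⟩ := u.exists_abs_incrDensityDeriv_le ha
  exact integrable_of_abs_le_japSum
    ((u.continuous_incrDensityDeriv ha).comp (by fun_prop : Continuous fun x : ℝ => (t, x)))
    fun x => hK t x ht

theorem integrable_symmDensity (ha : 1 < a) {t : ℝ} (ht : 0 ≤ t) :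
    Integrable (u.symmDensity a t) := by
  obtain ⟨K, -, hK⟩ := u.exists_abs_symmDensity_le ha
  exact integrable_of_abs_le_japSum
    ((u.continuous_symmDensity a).comp (by fun_prop : Continuous fun x : ℝ => (t, x)))
    fun x => hK t x ht

theorem incrEnergy_nonneg (ha : 1 < a) {t : ℝ} (ht : 0 ≤ t) : 0 ≤ u.incrEnergy a t :=
  integral_nonneg fun x => mul_nonneg (by positivity)
    (sub_nonneg.2 (japPrimitive_mono ha (by linarith)))

theorem exists_abs_incrEnergy_le (ha : 1 < a) : ∃ K, 0 ≤ K ∧ ∀ t, 0 ≤ t →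
    |u.incrEnergy a t| ≤ K * (min t 1) ^ 3 := by
  obtain ⟨K, hK0, hK⟩ := u.exists_abs_incrDensity_le ha
  have hI : 0 ≤ ∫ x, jap x ^ (-2 : ℝ) := integral_nonneg fun s => (jap_rpow_pos s _).le
  refine ⟨K * (2 * ∫ x, jap x ^ (-2 : ℝ)), by positivity, fun t ht => ?_⟩
  exact (abs_integral_le_of_abs_le_japSum fun x => hK t x ht).trans_eq (by ring)

theorem hasDerivAt_incrDensity (ha : 1 < a) (t x : ℝ) :
    HasDerivAt (fun t => u.incrDensity a t x) (u.incrDensityDeriv a t x) t := by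
  have h1 : HasDerivAt (fun t => u (x + t)) (deriv u (x + t)) t :=
    HasDerivAt.comp_const_add x t (u.hasDerivAt (x + t))
  have h2 : HasDerivAt (fun t => japPrimitive a (x + t)) (jap (x + t) ^ (-a)) t :=
    HasDerivAt.comp_const_add x t (hasDerivAt_japPrimitive ha (x + t))
  have := (((h1.sub_const (u x)).pow 2).const_mul (1 / 2)).mul (h2.sub_const (japPrimitive a x))
  refine this.congr_deriv ?_
  rw [incrDensityDeriv]
  simp only [Pi.pow_apply]
  push_cast
  ring

theorem hasDerivAt_incrEnergy (ha : 1 < a) {t : ℝ} (ht : 0 < t) :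
    HasDerivAt (u.incrEnergy a) (∫ x, u.incrDensityDeriv a t x) t := by
  obtain ⟨K, hK0, hK⟩ := u.exists_abs_incrDensityDeriv_le ha
  refine (hasDerivAt_integral_of_dominated_loc_of_deriv_le (F := u.incrDensity a)
    (F' := u.incrDensityDeriv a) (s := Metric.ball t 1 ∩ Set.Ioi 0)
    (bound := fun x => K * 2 ^ (2 : ℝ) * japSum t x)
    (Filter.inter_mem (Metric.ball_mem_nhds t one_pos) (Ioi_mem_nhds ht)) (.of_forall fun s => ?_)
    (u.integrable_incrDensity ha ht.le) (u.integrable_incrDensityDeriv ha ht.le).1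
    (.of_forall fun x s hs => ?_) ((integrable_japSum t).const_mul _)
    (.of_forall fun x s _ => u.hasDerivAt_incrDensity ha s x)).2
  · exact ((u.continuous_incrDensity ha).comp
      (by fun_prop : Continuous fun x : ℝ => (s, x))).aestronglyMeasurable
  · have hs0 : 0 < s := hs.2
    have hst : |s - t| < 1 := hs.1
    have h1 : jap (x + s) ^ (-2 : ℝ) ≤ 2 ^ (2 : ℝ) * jap (x + t) ^ (-2 : ℝ) :=
      jap_rpow_neg_le_of_abs_sub_le_one zero_le_two (by rw [add_sub_add_left_eq_sub]; exact hst.le)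
    have hx := jap_rpow_pos x (-2)
    have h4 : (1 : ℝ) ≤ 2 ^ (2 : ℝ) := by norm_num
    have h2 : japSum s x ≤ 2 ^ (2 : ℝ) * japSum t x := by
      rw [japSum, japSum]; nlinarith
    have hm : (min s 1) ^ 2 ≤ 1 := pow_le_one₀ (le_min hs0.le zero_le_one) (min_le_right _ _)
    calc _ ≤ K * (min s 1) ^ 2 * japSum s x := hK s x hs0.le
      _ ≤ K * 1 * (2 ^ (2 : ℝ) * japSum t x) := by
          gcongr
          exact (japSum_pos s x).le
      _ = _ := by ring


theorem aestronglyMeasurable_integral_of_continuous {F : ℝ → ℝ → ℝ}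
    (hF : Continuous fun p : ℝ × ℝ => F p.1 p.2) {μ : Measure ℝ} :
    AEStronglyMeasurable (fun t => ∫ x, F t x) μ :=
  (hF.stronglyMeasurable.integral_prod_right (ν := volume)).aestronglyMeasurable

theorem integrableOn_rpow_mul_integral {α : ℝ} (h0 : 0 < α) (h2 : α < 2) {F : ℝ → ℝ → ℝ}
    (hF : Continuous fun p : ℝ × ℝ => F p.1 p.2)
    (hb : ∃ K, 0 ≤ K ∧ ∀ t x, 0 ≤ t → |F t x| ≤ K * (min t 1) ^ 2 * japSum t x) :
    IntegrableOn (fun t => t ^ (-1 - α) * ∫ x, F t x) (Set.Ioi 0) := by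
  obtain ⟨K, hK0, hK⟩ := hb
  have hb t (ht : 0 ≤ t) := abs_integral_le_of_abs_le_japSum fun x => hK t x ht
  refine integrableOn_Ioi_of_bounds (C := K * (2 * ∫ x, jap x ^ (-2 : ℝ))) h0 h2
    (aestronglyMeasurable_integral_of_continuous hF)
    (fun t ht ht1 => (hb t ht.le).trans_eq ?_) (fun t ht => (hb t (by linarith)).trans_eq ?_)
  · rw [min_eq_left ht1]; ring
  · rw [min_eq_right ht.le]; ring

theorem integrableOn_incrDensityDeriv {α : ℝ} (h0 : 0 < α) (h2 : α < 2) (ha : 1 < a) :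
    IntegrableOn (fun t => t ^ (-1 - α) * ∫ x, u.incrDensityDeriv a t x) (Set.Ioi 0) :=
  integrableOn_rpow_mul_integral h0 h2 (u.continuous_incrDensityDeriv ha)
    (u.exists_abs_incrDensityDeriv_le ha)

theorem integrableOn_symmEnergy {α : ℝ} (h0 : 0 < α) (h2 : α < 2) (ha : 1 < a) :
    IntegrableOn (fun t => t ^ (-1 - α) * u.symmEnergy a t) (Set.Ioi 0) :=
  integrableOn_rpow_mul_integral h0 h2 (u.continuous_symmDensity a)
    (u.exists_abs_symmDensity_le ha)

theorem integrableOn_incrEnergy_div {α : ℝ} (h0 : 0 < α) (h2 : α < 2) (ha : 1 < a) :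
    IntegrableOn (fun t => t ^ (-1 - α) * (u.incrEnergy a t / t)) (Set.Ioi 0) := by
  obtain ⟨K, hK0, hK⟩ := u.exists_abs_incrEnergy_le ha
  refine integrableOn_Ioi_of_bounds (C := K) h0 h2
    ((aestronglyMeasurable_integral_of_continuous (u.continuous_incrDensity ha)).mul
      measurable_inv.aestronglyMeasurable) (fun t ht ht1 => ?_) (fun t ht => ?_)
  · rw [abs_div, abs_of_pos ht, div_le_iff₀ ht]
    refine (hK t ht.le).trans_eq ?_
    rw [min_eq_left ht1]; ring
  · have ht0 : 0 < t := by linarith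
    rw [abs_div, abs_of_pos ht0, div_le_iff₀ ht0]
    refine (hK t ht0.le).trans ?_
    rw [min_eq_right ht.le]; nlinarith

theorem integral_rpow_mul_incrDensityDeriv {α : ℝ} (h0 : 0 < α) (h2 : α < 2) (ha : 1 < a) :
    ∫ t in Set.Ioi 0, t ^ (-1 - α) * ∫ x, u.incrDensityDeriv a t x
      = (1 + α) * ∫ t in Set.Ioi 0, t ^ (-1 - α) * (u.incrEnergy a t / t) := by
  obtain ⟨K, hK0, hK⟩ := u.exists_abs_incrEnergy_le ha
  have hd := u.integrableOn_incrDensityDeriv h0 h2 ha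
  have hm := (u.integrableOn_incrEnergy_div h0 h2 ha).const_mul (1 + α)
  have hzero : (0 : ℝ) ^ (-1 - α) = 0 := Real.zero_rpow (by linarith)
  have key := integral_Ioi_of_hasDerivAt_of_tendsto (a := 0) (m := 0)
    (f := fun t => t ^ (-1 - α) * u.incrEnergy a t)
    (f' := fun t => (t ^ (-1 - α) * ∫ x, u.incrDensityDeriv a t x)
      - (1 + α) * (t ^ (-1 - α) * (u.incrEnergy a t / t))) ?_ (fun t ht => ?_) (hd.sub hm) ?_
  · rw [integral_sub hd hm, integral_const_mul, hzero] at key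
    linarith
  · have hlim : Filter.Tendsto (fun t : ℝ => K * t ^ (2 - α)) (nhdsWithin 0 (Set.Ici 0)) (nhds 0) := by
      have : ContinuousAt (fun t : ℝ => K * t ^ (2 - α)) 0 :=
        continuousAt_const.mul (Real.continuousAt_rpow_const 0 _ (Or.inr (by linarith)))
      have h := this.continuousWithinAt (s := Set.Ici 0)
      rwa [ContinuousWithinAt, Real.zero_rpow (by linarith), mul_zero] at h
    rw [ContinuousWithinAt, hzero, zero_mul]
    refine squeeze_zero_norm' ?_ hlim
    filter_upwards [self_mem_nhdsWithin] with t ht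
    rcases (Set.mem_Ici.1 ht).eq_or_lt with rfl | ht
    · simp [hzero, Real.zero_rpow (by linarith : 2 - α ≠ 0)]
    · rw [norm_mul, Real.norm_of_nonneg (by positivity), Real.norm_eq_abs]
      have h1 : |u.incrEnergy a t| ≤ K * t ^ 3 := (hK t ht.le).trans
        (mul_le_mul_of_nonneg_left (pow_le_pow_left₀ (by positivity) (min_le_left _ _) 3) hK0)
      calc _ ≤ t ^ (-1 - α) * (K * t ^ 3) := by gcongr
        _ = K * (t ^ (-1 - α) * t ^ (3 : ℝ)) := by norm_cast; ring
        _ = _ := by rw [← Real.rpow_add ht]; ring_nf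
  · have ht : 0 < t := ht
    refine ((Real.hasDerivAt_rpow_const (Or.inl ht.ne')).mul (u.hasDerivAt_incrEnergy ha ht)).congr_deriv ?_
    rw [Real.rpow_sub_one ht.ne']
    ring
  · have hlim := (tendsto_rpow_neg_atTop (by linarith : 0 < 1 + α)).const_mul K
    rw [mul_zero] at hlim
    refine squeeze_zero_norm' ?_ hlim
    filter_upwards [Filter.eventually_gt_atTop 0] with t ht
    rw [norm_mul, Real.norm_of_nonneg (by positivity), Real.norm_eq_abs, neg_add', mul_comm]
    refine mul_le_mul_of_nonneg_right ((hK t ht.le).trans ?_) (by positivity)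
    exact mul_le_of_le_one_right hK0 (pow_le_one₀ (by positivity) (min_le_right _ _))


theorem integral_incr_mul_deriv_incr (ha : 1 < a) {t : ℝ} (ht : 0 ≤ t) :
    ∫ x, ((u (x + t) - u x) * (deriv u (x + t) - deriv u x) * japPrimitive a x
      + 1 / 2 * (u (x + t) - u x) ^ 2 * jap x ^ (-a)) = 0
    ∧ Integrable fun x => (u (x + t) - u x) * (deriv u (x + t) - deriv u x) * japPrimitive a x
      + 1 / 2 * (u (x + t) - u x) ^ 2 * jap x ^ (-a) := by
  obtain ⟨A, hA, hu⟩ := u.exists_abs_sub_le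
  obtain ⟨B, hB, hu'⟩ := u.exists_abs_deriv_le
  have hub y : |deriv u y| ≤ B :=
    (hu' _).trans (mul_le_of_le_one_right hB (jap_rpow_neg_le_one zero_le_two _))
  have hφ := abs_japPrimitive_le ha
  set I := ∫ s, jap s ^ (-a) with hI
  have hI0 : 0 ≤ I := integral_nonneg fun s => (jap_rpow_pos s _).le
  have hm0 : 0 ≤ min t 1 := le_min ht zero_le_one
  have hm1 : min t 1 ≤ 1 := min_le_right _ _
  have hδ x : |u (x + t) - u x| ≤ A * (1 * japSum t x) := by
    refine (hu x t ht).trans ?_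
    have := (japSum_pos t x).le
    gcongr
  have hδ2 x : |1 / 2 * (u (x + t) - u x) ^ 2| ≤ A ^ 2 * 1 ^ 2 * japSum t x :=
    abs_half_sq_mul_le (japSum_pos t x).le (japSum_le_two t x) (hδ x)
  have hc1 := continuous_japPrimitive ha
  have hc2 := u.continuous_deriv
  have hc3 := continuous_jap_rpow (-a)
  have hE : Integrable fun x =>
      (u (x + t) - u x) * (deriv u (x + t) - deriv u x) * japPrimitive a x
      + 1 / 2 * (u (x + t) - u x) ^ 2 * jap x ^ (-a) := by
    refine integrable_of_abs_le_japSum (t := t) (K := A * (B + B) * I + A ^ 2) (by fun_prop) fun x => ?_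
    have h1 : |(u (x + t) - u x) * (deriv u (x + t) - deriv u x) * japPrimitive a x|
        ≤ A * (1 * japSum t x) * (B + B) * I := by
      rw [abs_mul, abs_mul]
      have := (japSum_pos t x).le
      gcongr
      exacts [hδ x, (abs_sub _ _).trans (add_le_add (hub _) (hub _)), hφ x]
    have h2 : |1 / 2 * (u (x + t) - u x) ^ 2 * jap x ^ (-a)| ≤ A ^ 2 * 1 ^ 2 * japSum t x := by
      rw [abs_mul, abs_of_pos (jap_rpow_pos x (-a))]
      exact (mul_le_of_le_one_right (abs_nonneg _) (jap_rpow_neg_le_one (by linarith) _)).trans (hδ2 x)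
    refine (abs_add_le _ _).trans ((add_le_add h1 h2).trans_eq ?_)
    ring
  refine ⟨integral_eq_zero_of_hasDerivAt_of_integrable
    (f := fun x => 1 / 2 * (u (x + t) - u x) ^ 2 * japPrimitive a x) (fun x => ?_) hE ?_, hE⟩
  · have h1 : HasDerivAt (fun x => u (x + t)) (deriv u (x + t)) x :=
      HasDerivAt.comp_add_const x t (u.hasDerivAt (x + t))
    refine ((((h1.sub (u.hasDerivAt x)).pow 2).const_mul (1 / 2)).mul
      (hasDerivAt_japPrimitive ha x)).congr_deriv ?_
    simp only [Pi.pow_apply, Pi.sub_apply]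
    push_cast
    ring
  · refine integrable_of_abs_le_japSum (t := t) (K := A ^ 2 * I) (by fun_prop) fun x => ?_
    rw [abs_mul]
    calc _ ≤ A ^ 2 * 1 ^ 2 * japSum t x * I :=
          mul_le_mul (hδ2 x) (hφ x) (abs_nonneg _) ((abs_nonneg _).trans (hδ2 x))
      _ = _ := by ring

theorem integral_incr_mul_incr (ha : 1 < a) {t : ℝ} (ht : 0 ≤ t) :
    ∫ x, (u (x + t) - u x) *
        (deriv u (x + t) * japPrimitive a (x + t) - deriv u x * japPrimitive a x)
      = (∫ x, u.incrDensityDeriv a t x) - u.symmEnergy a t := by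
  obtain ⟨h0, hi⟩ := u.integral_incr_mul_deriv_incr ha ht
  have h1 := u.integrable_incrDensityDeriv ha ht
  have h2 := u.integrable_symmDensity ha ht
  have h3 := integral_add (h1.sub h2) hi
  simp only [Pi.sub_apply] at h3
  rw [h0, add_zero, integral_sub h1 h2] at h3
  rw [symmEnergy, ← h3]
  congr 1 with x
  rw [incrDensityDeriv, symmDensity]
  ring

theorem integrable_deriv_mul_japPrimitive (ha : 1 < a) :
    Integrable fun x => deriv u x * japPrimitive a x :=
  (SchwartzMap.derivCLM ℝ ℝ u).integrable.mul_bdd (c := ∫ s, jap s ^ (-a))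
    (continuous_japPrimitive ha).aestronglyMeasurable (.of_forall (abs_japPrimitive_le ha))

theorem integral_rpow_mul_incr_mul_incr {α : ℝ} (h0 : 0 < α) (h2 : α < 2) (ha : 1 < a) :
    ∫ t in Set.Ioi 0, t ^ (-1 - α) * ∫ x, (u (x + t) - u x) *
        (deriv u (x + t) * japPrimitive a (x + t) - deriv u x * japPrimitive a x)
      = ∫ t in Set.Ioi 0, t ^ (-1 - α) *
        ((1 + α) * (u.incrEnergy a t / t) - u.symmEnergy a t) := by
  have hd := u.integrableOn_incrDensityDeriv h0 h2 ha
  have hm := (u.integrableOn_incrEnergy_div h0 h2 ha).const_mul (1 + α)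
  have hs := u.integrableOn_symmEnergy h0 h2 ha
  calc _ = ∫ t in Set.Ioi 0, (t ^ (-1 - α) * (∫ x, u.incrDensityDeriv a t x)
        - t ^ (-1 - α) * u.symmEnergy a t) :=
        setIntegral_congr_fun measurableSet_Ioi fun t ht => by
          rw [u.integral_incr_mul_incr ha (Set.mem_Ioi.1 ht).le, mul_sub]
    _ = ∫ t in Set.Ioi 0, ((1 + α) * (t ^ (-1 - α) * (u.incrEnergy a t / t))
        - t ^ (-1 - α) * u.symmEnergy a t) := by
        rw [integral_sub hd hs, integral_sub hm hs, u.integral_rpow_mul_incrDensityDeriv h0 h2 ha,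
          integral_const_mul]
    _ = _ := by congr 1 with t; ring

end SchwartzMap

theorem jap_neg (x : ℝ) : jap (-x) = jap x := by rw [jap, jap, neg_sq]

theorem jap_rpow_neg_mul_self (r x : ℝ) : jap x ^ (-r) * jap x ^ (-r) = jap x ^ (-(2 * r)) := by
  rw [← Real.rpow_add (jap_pos x)]
  ring_nf

namespace SchwartzMap

variable (u : 𝓢(ℝ, ℝ))

theorem integrable_sq_mul {b : ℝ → ℝ} (hb : Continuous b) {c : ℝ} (hc : ∀ x, |b x| ≤ c) :
    Integrable fun x => u x ^ 2 * b x := by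
  obtain ⟨A, hA, hu⟩ := u.exists_abs_le
  have h : Integrable fun x => u x * u x :=
    u.integrable.mul_bdd (c := A) u.continuous.aestronglyMeasurable (.of_forall fun x =>
      (hu x).trans (mul_le_of_le_one_right hA (jap_rpow_neg_le_one zero_le_two _)))
  simp only [sq]
  exact h.mul_bdd hb.aestronglyMeasurable (.of_forall hc)

theorem integrable_sq_mul_jap {a : ℝ} (ha : 0 ≤ a) (s : ℝ) :
    Integrable fun x => u x ^ 2 * jap (x + s) ^ (-a) :=
  u.integrable_sq_mul ((continuous_jap_rpow (-a)).comp (continuous_add_const s))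
    (c := 1) fun _ => by
      rw [abs_of_pos (jap_rpow_pos _ _)]; exact jap_rpow_neg_le_one ha _

theorem integrable_sq_mul_jap_self {a : ℝ} (ha : 0 ≤ a) :
    Integrable fun x => u x ^ 2 * jap x ^ (-a) := by
  simpa using u.integrable_sq_mul_jap ha 0

theorem integral_sq_mul_jap_nonneg (a : ℝ) : 0 ≤ ∫ x, u x ^ 2 * jap x ^ (-a) :=
  integral_nonneg fun _ => mul_nonneg (sq_nonneg _) (jap_rpow_pos _ _).le

theorem integrable_sq_mul_jap_mul_jap {r : ℝ} (hr : 0 ≤ r) (s : ℝ) :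
    Integrable fun x => u x ^ 2 * (jap x ^ (-r) * jap (x + s) ^ (-r)) := by
  have hc := continuous_jap_rpow (-r)
  refine u.integrable_sq_mul (hc.mul (hc.comp (by fun_prop : Continuous fun x => x + s)))
    (c := 1) fun x => ?_
  have h1 := jap_rpow_pos x (-r)
  have h2 := jap_rpow_pos (x + s) (-r)
  rw [abs_of_pos (mul_pos h1 h2)]
  exact mul_le_one₀ (jap_rpow_neg_le_one hr _) h2.le (jap_rpow_neg_le_one hr _)

/-- The remainder in the product rule for the squared increments of `⟨·⟩^{-r} u`. -/
noncomputable def incrRemainder (r t x : ℝ) : ℝ :=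
  (jap (x + t) ^ (-r) - jap x ^ (-r)) *
    (u (x + t) ^ 2 * jap (x + t) ^ (-r) - u x ^ 2 * jap x ^ (-r))

theorem exists_integral_incrRemainder_le {r : ℝ} (hr : 0 ≤ r) : ∃ C, 0 ≤ C ∧
    ∀ (u : 𝓢(ℝ, ℝ)) (t : ℝ), 0 ≤ t → t ≤ 1 → Integrable (u.incrRemainder r t) ∧
      ∫ x, u.incrRemainder r t x ≤ C * t ^ 2 * ∫ x, u x ^ 2 * jap x ^ (-(2 * r)) := by
  obtain ⟨C, hC, hT⟩ := exists_jap_rpow_taylor hr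
  refine ⟨2 * C, by positivity, fun u t ht ht1 => ?_⟩
  have i0 := u.integrable_sq_mul_jap_self (by positivity : 0 ≤ 2 * r)
  have ip := u.integrable_sq_mul_jap_mul_jap hr t
  have im := u.integrable_sq_mul_jap_mul_jap hr (-t)
  have i0' := i0.comp_add_right t
  have im' := im.comp_add_right t
  have e : u.incrRemainder r t = fun x => (u (x + t) ^ 2 * jap (x + t) ^ (-(2 * r))
      - u (x + t) ^ 2 * (jap (x + t) ^ (-r) * jap (x + t + -t) ^ (-r)))
      + (u x ^ 2 * jap x ^ (-(2 * r)) - u x ^ 2 * (jap x ^ (-r) * jap (x + t) ^ (-r))) := by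
    ext x
    rw [incrRemainder, ← jap_rpow_neg_mul_self, ← jap_rpow_neg_mul_self, add_neg_cancel_right]
    ring
  refine ⟨e ▸ (i0'.sub im').add (i0.sub ip), ?_⟩
  have h1 : ∫ x, u.incrRemainder r t x = ∫ x, u x ^ 2 * (jap x ^ (-r) *
      (2 * jap x ^ (-r) - jap (x + t) ^ (-r) - jap (x + -t) ^ (-r))) := by
    have h2 := integral_add (i0'.sub im') (i0.sub ip)
    have h3 := integral_add (i0.sub im) (i0.sub ip)
    simp only [Pi.sub_apply] at h2 h3
    rw [integral_sub i0' im', integral_add_right_eq_self (fun x => u x ^ 2 * jap x ^ (-(2 * r))),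
      integral_add_right_eq_self (fun x => u x ^ 2 * (jap x ^ (-r) * jap (x + -t) ^ (-r))),
      ← integral_sub i0 im, ← h3] at h2
    rw [e, h2]
    congr 1 with x
    rw [← jap_rpow_neg_mul_self]
    ring
  rw [h1, ← integral_const_mul]
  refine integral_mono (((i0.sub im).add (i0.sub ip)).congr (.of_forall fun x => ?_))
    (i0.const_mul _) fun x => ?_
  · simp only [Pi.sub_apply, Pi.add_apply]
    rw [← jap_rpow_neg_mul_self]
    ring
  · have h2 := (abs_le.1 (hT x t (by rwa [abs_of_nonneg ht]))).1
    have h3 := (abs_le.1 (hT x (-t) (by rwa [abs_neg, abs_of_nonneg ht]))).1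
    beta_reduce
    rw [← jap_rpow_neg_mul_self]
    have h4 : 2 * jap x ^ (-r) - jap (x + t) ^ (-r) - jap (x + -t) ^ (-r)
        ≤ 2 * (C * jap x ^ (-r) * t ^ 2) := by linarith [neg_sq t]
    have h5 := jap_rpow_pos x (-r)
    calc _ ≤ u x ^ 2 * (jap x ^ (-r) * (2 * (C * jap x ^ (-r) * t ^ 2))) := by gcongr
      _ = _ := by ring

theorem japMul_incr_sq (r t x : ℝ) :
    (u.japMul r (x + t) - u.japMul r x) * (u.japMul r (x + t) - u.japMul r x)
      = jap x ^ (-r) * jap (x + t) ^ (-r) * (u (x + t) - u x) ^ 2 + u.incrRemainder r t x := by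
  rw [incrRemainder, japMul_apply, japMul_apply]
  ring

theorem integrable_incr_sq (t : ℝ) :
    Integrable fun x => (u (x + t) - u x) * (u (x + t) - u x) := by
  have h : Integrable fun x => u x ^ 2 := by simpa using u.integrable_sq_mul continuous_const (b := 1) (c := 1) (by simp)
  refine ((h.comp_add_right t).add h).const_mul 2 |>.mono'
    (by fun_prop : Continuous _).aestronglyMeasurable (.of_forall fun x => ?_)
  rw [Real.norm_of_nonneg (mul_self_nonneg _)]
  simp only [Pi.add_apply]
  nlinarith [sq_nonneg (u (x + t) + u x)]

theorem exists_le_of_le_one {α r : ℝ} (hα : 1 ≤ α) (hr : 1 / 2 < r) : ∃ C, 0 ≤ C ∧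
    ∀ (u : 𝓢(ℝ, ℝ)) (t : ℝ), 0 < t → t ≤ 1 →
      -(C * t ^ 2 * ∫ x, u x ^ 2 * jap x ^ (-(2 * r))) ≤
        (1 + α) * (u.incrEnergy (2 * r) t / t) - u.symmEnergy (2 * r) t
        - (α - 1) / 2 * ∫ x, (u.japMul r (x + t) - u.japMul r x)
          * (u.japMul r (x + t) - u.japMul r x) := by
  have ha : 1 < 2 * r := by linarith
  obtain ⟨C, hC, hR⟩ := exists_integral_incrRemainder_le (by linarith : 0 ≤ r)
  obtain ⟨D, hD, hT⟩ := exists_japPrimitive_trapezoid ha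
  refine ⟨(1 + α) * D * (2 ^ (2 * r) + 1) + (α - 1) / 2 * C, by
    have : 0 ≤ α - 1 := by linarith
    positivity, fun u t ht ht1 => ?_⟩
  obtain ⟨hRi, hRb⟩ := hR u t ht.le ht1
  set U := ∫ x, u x ^ 2 * jap x ^ (-(2 * r)) with hU
  have iU := u.integrable_sq_mul_jap_self (by linarith : 0 ≤ 2 * r)
  have iU' := iU.comp_add_right t
  have iM := ((u.integrable_incrDensity ha ht.le).const_mul ((1 + α) / t))
  have iN := u.integrable_symmDensity ha ht.le
  have iH := ((u.japMul r).integrable_incr_sq t).const_mul ((α - 1) / 2)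
  have iA := (iU'.const_mul (2 ^ (2 * r))).add iU |>.const_mul ((1 + α) * D * t ^ 2)
  have iB := hRi.const_mul ((α - 1) / 2)
  have hmono := integral_mono (iA.neg.sub iB) ((iM.sub iN).sub iH) fun x => ?_
  · rw [integral_sub' iA.neg iB, integral_neg', integral_const_mul, integral_add' (iU'.const_mul _) iU,
      integral_sub' (iM.sub iN) iH, integral_sub' iM iN, integral_const_mul, integral_const_mul,
      integral_const_mul, integral_const_mul,
      integral_add_right_eq_self (fun x => u x ^ 2 * jap x ^ (-(2 * r)))] at hmono
    have h := mul_le_mul_of_nonneg_left hRb (by linarith : 0 ≤ (α - 1) / 2)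
    calc _ ≤ -((1 + α) * D * t ^ 2 * (2 ^ (2 * r) * U + U))
          - (α - 1) / 2 * ∫ x, u.incrRemainder r t x := by linarith
      _ ≤ _ := hmono
      _ = _ := by rw [incrEnergy, symmEnergy]; ring
  · simp only [Pi.sub_apply, Pi.neg_apply, Pi.add_apply]
    rw [japMul_incr_sq, incrDensity, symmDensity]
    have h1 := hT x t ht.le ht1
    have h2 : jap x ^ (-(2 * r)) ≤ 2 ^ (2 * r) * jap (x + t) ^ (-(2 * r)) :=
      jap_rpow_neg_le_of_abs_sub_le_one (by linarith)
        (by rw [sub_add_cancel_left, abs_neg, abs_of_pos ht]; exact ht1)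
    have h3 : (jap x ^ (-(2 * r)) + jap (x + t) ^ (-(2 * r))) / 2 - D * jap x ^ (-(2 * r)) * t ^ 2
        ≤ (japPrimitive (2 * r) (x + t) - japPrimitive (2 * r) x) / t := by
      rw [le_div_iff₀ ht]; linarith
    have h4 := mul_le_mul_of_nonneg_left h3
      (by positivity : 0 ≤ (1 + α) * (1 / 2 * (u (x + t) - u x) ^ 2))
    have h5 : 1 / 2 * (u (x + t) - u x) ^ 2 * jap x ^ (-(2 * r))
        ≤ 2 ^ (2 * r) * (u (x + t) ^ 2 * jap (x + t) ^ (-(2 * r))) + u x ^ 2 * jap x ^ (-(2 * r)) := by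
      have h6 : 1 / 2 * (u (x + t) - u x) ^ 2 ≤ u (x + t) ^ 2 + u x ^ 2 := by
        nlinarith [sq_nonneg (u (x + t) + u x)]
      have h7 := mul_le_mul_of_nonneg_right h6 (jap_rpow_pos x (-(2 * r))).le
      have h8 := mul_le_mul_of_nonneg_left h2 (sq_nonneg (u (x + t)))
      linarith
    have h9 := mul_le_mul_of_nonneg_left h5 (by positivity : 0 ≤ (1 + α) * D * t ^ 2)
    have h10 : 0 ≤ 1 / 2 * (u (x + t) - u x) ^ 2 *
        ((α - 1) / 2 * (jap x ^ (-r) - jap (x + t) ^ (-r)) ^ 2) :=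
      mul_nonneg (by positivity) (mul_nonneg (by linarith) (sq_nonneg _))
    simp only [← jap_rpow_neg_mul_self] at *
    have h11 : (1 + α) * (1 / 2 * (u (x + t) - u x) ^ 2) *
        ((japPrimitive (2 * r) (x + t) - japPrimitive (2 * r) x) / t)
      = (1 + α) / t * (1 / 2 * (u (x + t) - u x) ^ 2
        * (japPrimitive (2 * r) (x + t) - japPrimitive (2 * r) x)) := by ring
    linarith

/-- The correlation of `u² ⟨·⟩^{-a}` with `⟨·⟩^{-a}`. -/
noncomputable def japCorrelation (a s : ℝ) : ℝ :=
  ∫ x, u x ^ 2 * jap x ^ (-a) * jap (x + s) ^ (-a)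

theorem integrable_sq_mul_jap_mul_jap' {a : ℝ} (ha : 0 ≤ a) (s : ℝ) :
    Integrable fun x => u x ^ 2 * jap x ^ (-a) * jap (x + s) ^ (-a) := by
  simpa only [mul_assoc] using u.integrable_sq_mul_jap_mul_jap ha s

theorem japCorrelation_neg_eq_convolution (a s : ℝ) :
    u.japCorrelation a (-s) = MeasureTheory.convolution (fun x => u x ^ 2 * jap x ^ (-a))
      (fun x => jap x ^ (-a)) (ContinuousLinearMap.mul ℝ ℝ) volume s := by
  rw [japCorrelation, MeasureTheory.convolution]
  congr 1 with x
  rw [ContinuousLinearMap.mul_apply', ← jap_neg (s - x), neg_sub, sub_eq_add_neg]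

theorem integrable_japCorrelation_neg {a : ℝ} (ha : 1 < a) :
    Integrable (fun s => u.japCorrelation a (-s)) ∧ ∫ s, u.japCorrelation a (-s)
      = (∫ x, u x ^ 2 * jap x ^ (-a)) * ∫ x, jap x ^ (-a) := by
  have h1 := u.integrable_sq_mul_jap_self (by linarith : 0 ≤ a)
  have h2 := integrable_jap_rpow_neg ha
  simp only [japCorrelation_neg_eq_convolution]
  exact ⟨h1.integrable_convolution _ h2, integral_convolution _ h1 h2⟩

theorem integrable_japCorrelation {a : ℝ} (ha : 1 < a) :
    Integrable (u.japCorrelation a) ∧ ∫ s, u.japCorrelation a s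
      = (∫ x, u x ^ 2 * jap x ^ (-a)) * ∫ x, jap x ^ (-a) := by
  obtain ⟨h1, h2⟩ := u.integrable_japCorrelation_neg ha
  refine ⟨by simpa using h1.comp_neg, ?_⟩
  rw [← h2, integral_neg_eq_self (u.japCorrelation a)]

theorem japCorrelation_nonneg (a s : ℝ) : 0 ≤ u.japCorrelation a s :=
  integral_nonneg fun _ => mul_nonneg (mul_nonneg (sq_nonneg _) (jap_rpow_pos _ _).le)
    (jap_rpow_pos _ _).le

theorem exists_rpow_mul_integral_sq_mul_jap_le {a b : ℝ} (ha : 0 ≤ a) (hab : a ≤ b) :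
    ∃ C, 0 ≤ C ∧ ∀ (u : 𝓢(ℝ, ℝ)) (t s : ℝ), 1 ≤ t → |s| = t →
      t ^ (-b) * ∫ x, u x ^ 2 * jap (x + s) ^ (-a)
        ≤ C * (t ^ (-b) * (∫ x, u x ^ 2 * jap x ^ (-a)) + u.japCorrelation a s) := by
  obtain ⟨C, hC, h⟩ := exists_rpow_mul_jap_rpow_le ha hab
  refine ⟨C, hC, fun u t s ht hs => ?_⟩
  have i1 := u.integrable_sq_mul_jap_self ha
  have i2 := u.integrable_sq_mul_jap_mul_jap' ha s
  rw [japCorrelation, ← integral_const_mul, ← integral_const_mul,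
    ← integral_add (i1.const_mul _) i2, ← integral_const_mul]
  refine integral_mono ((u.integrable_sq_mul_jap ha s).const_mul _)
    (((i1.const_mul _).add i2).const_mul _) fun x => ?_
  have := mul_le_mul_of_nonneg_left (h x (x + s) t ht (by rwa [add_sub_cancel_left]))
    (sq_nonneg (u x))
  beta_reduce
  linarith

theorem symmEnergy_le {a : ℝ} (ha : 1 < a) {t : ℝ} (ht : 0 ≤ t) :
    u.symmEnergy a t ≤ 2 * (∫ x, u x ^ 2 * jap x ^ (-a))
      + (∫ x, u x ^ 2 * jap (x + t) ^ (-a)) + ∫ x, u x ^ 2 * jap (x + -t) ^ (-a) := by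
  have ha0 : 0 ≤ a := by linarith
  have i1 := u.integrable_sq_mul_jap_self ha0
  have i2 := u.integrable_sq_mul_jap ha0 t
  have i3 := u.integrable_sq_mul_jap ha0 (-t)
  have i1' := i1.comp_add_right t
  have i3' := i3.comp_add_right t
  have hmono := integral_mono (u.integrable_symmDensity ha ht) (((i1'.add i1).add i2).add i3')
    fun x => ?_
  · rw [integral_add' ((i1'.add i1).add i2) i3', integral_add' (i1'.add i1) i2,
      integral_add' i1' i1, integral_add_right_eq_self (fun x => u x ^ 2 * jap x ^ (-a)),
      integral_add_right_eq_self (fun x => u x ^ 2 * jap (x + -t) ^ (-a))] at hmono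
    rw [symmEnergy]
    linarith
  · simp only [Pi.add_apply, symmDensity, add_neg_cancel_right]
    have h1 := jap_rpow_pos x (-a)
    have h2 := jap_rpow_pos (x + t) (-a)
    have h3 : 1 / 2 * (u (x + t) - u x) ^ 2 ≤ u (x + t) ^ 2 + u x ^ 2 := by
      nlinarith [sq_nonneg (u (x + t) + u x)]
    have := mul_le_mul_of_nonneg_right h3 (add_pos h2 h1).le
    linarith

theorem integral_japMul_incr_sq_le {r : ℝ} (hr : 0 ≤ r) (t : ℝ) :
    ∫ x, (u.japMul r (x + t) - u.japMul r x) * (u.japMul r (x + t) - u.japMul r x)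
      ≤ 4 * ∫ x, u x ^ 2 * jap x ^ (-(2 * r)) := by
  have i1 := u.integrable_sq_mul_jap_self (by linarith : 0 ≤ 2 * r)
  have i1' := i1.comp_add_right t
  have hmono := integral_mono ((u.japMul r).integrable_incr_sq t) ((i1'.add i1).const_mul 2)
    fun x => ?_
  · rw [integral_const_mul, integral_add' i1' i1,
      integral_add_right_eq_self (fun x => u x ^ 2 * jap x ^ (-(2 * r)))] at hmono
    linarith
  · simp only [Pi.add_apply, japMul_apply, ← jap_rpow_neg_mul_self]
    nlinarith [sq_nonneg (jap (x + t) ^ (-r) * u (x + t) + jap x ^ (-r) * u x)]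

theorem exists_le_of_one_le {α r : ℝ} (hα : 1 ≤ α) (hr : 1 / 2 < r) (hr2 : r ≤ (α + 1) / 2) :
    ∃ C, 0 ≤ C ∧ ∀ (u : 𝓢(ℝ, ℝ)) (t : ℝ), 1 ≤ t →
      -(C * (t ^ (-1 - α) * (∫ x, u x ^ 2 * jap x ^ (-(2 * r)))
        + (u.japCorrelation (2 * r) t + u.japCorrelation (2 * r) (-t)))) ≤
        t ^ (-1 - α) * ((1 + α) * (u.incrEnergy (2 * r) t / t) - u.symmEnergy (2 * r) t
        - (α - 1) / 2 * ∫ x, (u.japMul r (x + t) - u.japMul r x)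
          * (u.japMul r (x + t) - u.japMul r x)) := by
  have ha : 1 < 2 * r := by linarith
  obtain ⟨C, hC, h⟩ := exists_rpow_mul_integral_sq_mul_jap_le (by linarith : 0 ≤ 2 * r)
    (by linarith : 2 * r ≤ 1 + α)
  refine ⟨2 * C + 2 + 2 * (α - 1), by linarith, fun u t ht => ?_⟩
  have ht0 : 0 < t := by linarith
  set U := ∫ x, u x ^ 2 * jap x ^ (-(2 * r)) with hU
  have hU0 : 0 ≤ U := u.integral_sq_mul_jap_nonneg _
  have h1 := h u t t ht (abs_of_pos ht0)
  have h2 := h u t (-t) ht (by rw [abs_neg, abs_of_pos ht0])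
  have h3 := u.symmEnergy_le ha ht0.le
  have h4 := mul_le_mul_of_nonneg_left (u.integral_japMul_incr_sq_le (by linarith : 0 ≤ r) t)
    (by linarith : 0 ≤ (α - 1) / 2)
  have h5 : 0 ≤ (1 + α) * (u.incrEnergy (2 * r) t / t) :=
    mul_nonneg (by linarith) (div_nonneg (u.incrEnergy_nonneg ha ht0.le) ht0.le)
  have h6 := u.japCorrelation_nonneg (2 * r) t
  have h7 := u.japCorrelation_nonneg (2 * r) (-t)
  rw [neg_add'] at h1 h2
  set T := t ^ (-1 - α)
  have hT : 0 ≤ T := by positivity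
  have h8 : -(2 * U + (∫ x, u x ^ 2 * jap (x + t) ^ (-(2 * r)))
      + (∫ x, u x ^ 2 * jap (x + -t) ^ (-(2 * r))) + (α - 1) / 2 * (4 * U)) ≤ _ :=
    (by linarith : _ ≤ (1 + α) * (u.incrEnergy (2 * r) t / t) - u.symmEnergy (2 * r) t
        - (α - 1) / 2 * ∫ x, (u.japMul r (x + t) - u.japMul r x)
          * (u.japMul r (x + t) - u.japMul r x))
  refine le_trans ?_ (mul_le_mul_of_nonneg_left h8 hT)
  have h9 : 0 ≤ (2 + 2 * (α - 1) + C) *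
      (u.japCorrelation (2 * r) t + u.japCorrelation (2 * r) (-t)) :=
    mul_nonneg (by linarith) (by linarith)
  linarith

theorem exists_neg_le_integral {α r : ℝ} (hα : 1 ≤ α) (hα2 : α < 2) (hr : 1 / 2 < r)
    (hr2 : r ≤ (α + 1) / 2) : ∃ C, 0 ≤ C ∧ ∀ (u : 𝓢(ℝ, ℝ)),
      IntegrableOn (fun t => t ^ (-1 - α) * ((1 + α) * (u.incrEnergy (2 * r) t / t)
        - u.symmEnergy (2 * r) t - (α - 1) / 2 * ∫ x, (u.japMul r (x + t) - u.japMul r x)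
          * (u.japMul r (x + t) - u.japMul r x))) (Set.Ioi 0) →
      -(C * ∫ x, u x ^ 2 * jap x ^ (-(2 * r))) ≤ ∫ t in Set.Ioi 0,
        t ^ (-1 - α) * ((1 + α) * (u.incrEnergy (2 * r) t / t) - u.symmEnergy (2 * r) t
        - (α - 1) / 2 * ∫ x, (u.japMul r (x + t) - u.japMul r x)
          * (u.japMul r (x + t) - u.japMul r x)) := by
  have ha : 1 < 2 * r := by linarith
  obtain ⟨A, hA, hsmall⟩ := exists_le_of_le_one hα hr
  obtain ⟨B, hB, hlarge⟩ := exists_le_of_one_le hα hr hr2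
  set I := ∫ x, jap x ^ (-(2 * r)) with hI
  have hI0 : 0 ≤ I := integral_nonneg fun s => (jap_rpow_pos s _).le
  have h2α : 0 < 2 - α := by linarith
  refine ⟨A * (2 - α)⁻¹ + B * (α⁻¹ + 2 * I), by positivity, fun u hi => ?_⟩
  set U := ∫ x, u x ^ 2 * jap x ^ (-(2 * r)) with hU
  have hi1 := hi.mono_set (Set.Ioc_subset_Ioi_self : Set.Ioc (0 : ℝ) 1 ⊆ _)
  have hi2 := hi.mono_set (Set.Ioi_subset_Ioi zero_le_one)
  rw [← Set.Ioc_union_Ioi_eq_Ioi zero_le_one,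
    setIntegral_union (Set.Ioc_disjoint_Ioi le_rfl) measurableSet_Ioi hi1 hi2]
  have h1 : -(A * (2 - α)⁻¹ * U) ≤ ∫ t in Set.Ioc 0 1, t ^ (-1 - α) *
      ((1 + α) * (u.incrEnergy (2 * r) t / t) - u.symmEnergy (2 * r) t
        - (α - 1) / 2 * ∫ x, (u.japMul r (x + t) - u.japMul r x)
          * (u.japMul r (x + t) - u.japMul r x)) := by
    have hp : IntegrableOn (fun t : ℝ => t ^ (1 - α)) (Set.Ioc 0 1) :=
      (intervalIntegral.intervalIntegrable_rpow' (by linarith)).1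
    have hv : ∫ t in Set.Ioc (0 : ℝ) 1, t ^ (1 - α) = (2 - α)⁻¹ := by
      rw [← intervalIntegral.integral_of_le zero_le_one, integral_rpow (Or.inl (by linarith)),
        Real.one_rpow, Real.zero_rpow (by linarith), ← one_div]
      ring_nf
    have := setIntegral_mono_on (hp.const_mul (-(A * U))) hi1 measurableSet_Ioc fun t ht => ?_
    · rw [integral_const_mul, hv] at this
      linarith
    · have ht0 : 0 < t := ht.1
      have e : t ^ (1 - α) = t ^ (-1 - α) * t ^ 2 := by
        rw [← Real.rpow_two, ← Real.rpow_add ht0]; ring_nf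
      rw [e]
      refine le_trans (le_of_eq ?_) (mul_le_mul_of_nonneg_left (hsmall u t ht.1 ht.2) (by positivity))
      ring
  have h2 : -(B * (α⁻¹ + 2 * I) * U) ≤ ∫ t in Set.Ioi 1, t ^ (-1 - α) *
      ((1 + α) * (u.incrEnergy (2 * r) t / t) - u.symmEnergy (2 * r) t
        - (α - 1) / 2 * ∫ x, (u.japMul r (x + t) - u.japMul r x)
          * (u.japMul r (x + t) - u.japMul r x)) := by
    have hp : IntegrableOn (fun t : ℝ => t ^ (-1 - α)) (Set.Ioi 1) :=
      integrableOn_Ioi_rpow_of_lt (by linarith) one_pos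
    have hv : ∫ t in Set.Ioi (1 : ℝ), t ^ (-1 - α) = α⁻¹ := by
      rw [integral_Ioi_rpow_of_lt (by linarith) one_pos, Real.one_rpow]
      have : -1 - α + 1 = -α := by ring
      rw [this, neg_div_neg_eq, one_div]
    obtain ⟨ic, hc⟩ := u.integrable_japCorrelation ha
    obtain ⟨ic', hc'⟩ := u.integrable_japCorrelation_neg ha
    have hle := setIntegral_le_integral (s := Set.Ioi 1) ic (.of_forall fun s => u.japCorrelation_nonneg _ s)
    have hle' := setIntegral_le_integral (s := Set.Ioi 1) ic' (.of_forall fun s => u.japCorrelation_nonneg _ _)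
    rw [hc] at hle
    rw [hc'] at hle'
    have is := ic.integrableOn (s := Set.Ioi 1) |>.add ic'.integrableOn
    have := setIntegral_mono_on (((hp.mul_const U).add is).const_mul B).neg hi2 measurableSet_Ioi
      fun t ht => hlarge u t (le_of_lt ht)
    rw [integral_neg', integral_const_mul, integral_add' (hp.mul_const U) is,
      integral_add' ic.integrableOn ic'.integrableOn, integral_mul_const, hv] at this
    have h3 := mul_le_mul_of_nonneg_left (add_le_add hle hle') hB
    linarith
  linarith

theorem exists_integral_fracD_le_of_lt {α r : ℝ} (hα : 1 ≤ α) (hα2 : α < 2) (hr : 1 / 2 < r)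
    (hr2 : r ≤ (α + 1) / 2) : ∃ C, 0 ≤ C ∧ ∀ u : 𝓢(ℝ, ℝ),
      (α - 1) / 2 * ∫ x, ‖fracD (α / 2) (u.japMul r).toComplex x‖ ^ 2
        ≤ (∫ x, fracD α u.toComplex x * ((deriv u x * japPrimitive (2 * r) x : ℝ) : ℂ)).re
          + C * ∫ x, u x ^ 2 * jap x ^ (-(2 * r)) := by
  have h0 : 0 < α := by linarith
  have ha : 1 < 2 * r := by linarith
  obtain ⟨C, hC, h⟩ := exists_neg_le_integral hα hα2 hr hr2
  have hκ := fracConst_pos h0 hα2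
  refine ⟨(2 * fracConst α)⁻¹ * C, by positivity, fun u => ?_⟩
  obtain ⟨-, e1⟩ := integral_fracD_mul h0 hα2 u (u.integrable_deriv_mul_japPrimitive ha)
  obtain ⟨iH, e2⟩ := integral_fracD_mul h0 hα2 (u.japMul r) (u.japMul r).integrable
  have e3 := u.integral_rpow_mul_incr_mul_incr h0 hα2 ha
  have iH' := iH.const_mul ((α - 1) / 2)
  have iJ := ((u.integrableOn_incrEnergy_div h0 hα2 ha).const_mul (1 + α)).sub
    (u.integrableOn_symmEnergy h0 hα2 ha)
  have e4 := integral_sub iJ iH'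
  have iF := iJ.sub iH'
  have hmain := h u (iF.congr (.of_forall fun t => by simp only [Pi.sub_apply]; ring))
  have e5 : (∫ x, fracD α (u.japMul r).toComplex x * conj ((u.japMul r).toComplex x))
      = ∫ x, fracD α (fun y => (u.japMul r y : ℂ)) x * (u.japMul r x : ℂ) := by
    congr 1 with x
    rw [coe_toComplex, Complex.conj_ofReal]
  rw [integral_norm_sq_fracD_half h0.le, e5, e2, coe_toComplex, e1, e3, ofReal_re, ofReal_re]
  rw [integral_const_mul] at e4
  have e6 : ∀ t : ℝ, t ^ (-1 - α) * ((1 + α) * (u.incrEnergy (2 * r) t / t) - u.symmEnergy (2 * r) t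
        - (α - 1) / 2 * ∫ x, (u.japMul r (x + t) - u.japMul r x)
          * (u.japMul r (x + t) - u.japMul r x)) =
      ((1 + α) * (t ^ (-1 - α) * (u.incrEnergy (2 * r) t / t)) - t ^ (-1 - α) * u.symmEnergy (2 * r) t)
      - (α - 1) / 2 * (t ^ (-1 - α) * ∫ x, (u.japMul r (x + t) - u.japMul r x)
          * (u.japMul r (x + t) - u.japMul r x)) := fun t => by ring
  have e7 : ∀ t : ℝ, t ^ (-1 - α) * ((1 + α) * (u.incrEnergy (2 * r) t / t) - u.symmEnergy (2 * r) t)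
    = (1 + α) * (t ^ (-1 - α) * (u.incrEnergy (2 * r) t / t)) - t ^ (-1 - α) * u.symmEnergy (2 * r) t :=
    fun t => by ring
  simp only [Pi.sub_apply] at e4
  simp only [e6] at hmain
  simp only [e7]
  rw [e4] at hmain
  have := mul_le_mul_of_nonneg_left hmain (by positivity : 0 ≤ (2 * fracConst α)⁻¹)
  linarith

theorem integrable_sq : Integrable fun x => u x ^ 2 := by
  simpa using u.integrable_sq_mul continuous_const (b := 1) (c := 1) (by simp)

theorem integral_neg_deriv_deriv_mul_deriv_mul_japPrimitive {a : ℝ} (ha : 1 < a) :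
    ∫ x, -deriv (deriv u) x * (deriv u x * japPrimitive a x)
      = 1 / 2 * ∫ x, deriv u x ^ 2 * jap x ^ (-a) := by
  set w := SchwartzMap.derivCLM ℝ ℝ u with hw
  have hwu : deriv u = w := rfl
  rw [hwu]
  obtain ⟨B, hB, hw'⟩ := w.exists_abs_le
  have hb x : |w x| ≤ B :=
    (hw' _).trans (mul_le_of_le_one_right hB (jap_rpow_neg_le_one zero_le_two _))
  have i1 := (w.integrable_sq_mul_jap_self (by linarith : 0 ≤ a)).const_mul (1 / 2)
  have i2 : Integrable fun x => -deriv w x * (w x * japPrimitive a x) :=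
    ((w.integrable_deriv_mul_japPrimitive ha).neg.mul_bdd (c := B)
      w.continuous.aestronglyMeasurable (.of_forall hb)).congr
      (.of_forall fun x => by simp only [Pi.neg_apply]; ring)
  have h := integral_eq_zero_of_hasDerivAt_of_integrable
    (f := fun x => 1 / 2 * (w x ^ 2 * japPrimitive a x))
    (f' := (fun x => 1 / 2 * (w x ^ 2 * jap x ^ (-a)))
      - fun x => -deriv w x * (w x * japPrimitive a x)) (fun x => ?_) (i1.sub i2)
    ((w.integrable_sq_mul (continuous_japPrimitive ha) (abs_japPrimitive_le ha)).const_mul _)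
  · rw [integral_sub' i1 i2, integral_const_mul] at h
    linarith
  · refine ((((w.hasDerivAt x).pow 2).mul (hasDerivAt_japPrimitive ha x)).const_mul
      (1 / 2)).congr_deriv ?_
    simp only [Pi.pow_apply, Pi.sub_apply]
    push_cast
    ring

theorem exists_integral_deriv_japMul_sq_le {r : ℝ} (hr : 0 ≤ r) : ∃ C, 0 ≤ C ∧ ∀ u : 𝓢(ℝ, ℝ),
    ∫ x, deriv (u.japMul r) x ^ 2
      ≤ (∫ x, deriv u x ^ 2 * jap x ^ (-(2 * r))) + C * ∫ x, u x ^ 2 * jap x ^ (-(2 * r)) := by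
  set C := r + r * (r + 2) with hC
  have hd x : HasDerivAt (japDeriv r) (deriv (japDeriv r) x) x ∧
      |deriv (japDeriv r) x| ≤ C * jap x ^ (-r) := by
    obtain ⟨d, hd, hdb⟩ := exists_hasDerivAt_japDeriv hr x
    rw [hd.deriv]
    exact ⟨hd, hdb⟩
  refine ⟨C, by positivity, fun u => ?_⟩
  have i0 := u.integrable_sq_mul_jap_self (by positivity : 0 ≤ 2 * r)
  have i1 : Integrable fun x => deriv (u.japMul r) x ^ 2 :=
    (SchwartzMap.derivCLM ℝ ℝ (u.japMul r)).integrable_sq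
  have i2 : Integrable fun x => deriv u x ^ 2 * jap x ^ (-(2 * r)) :=
    (SchwartzMap.derivCLM ℝ ℝ u).integrable_sq_mul_jap_self (by positivity : 0 ≤ 2 * r)
  have hb x : |u x ^ 2 * (jap x ^ (-r) * deriv (japDeriv r) x)|
      ≤ C * (u x ^ 2 * jap x ^ (-(2 * r))) := by
    have h1 := jap_rpow_pos x (-r)
    rw [← jap_rpow_neg_mul_self, abs_mul, abs_mul, abs_of_nonneg (sq_nonneg (u x)), abs_of_pos h1]
    calc _ ≤ u x ^ 2 * (jap x ^ (-r) * (C * jap x ^ (-r))) := by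
          gcongr
          exact (hd x).2
      _ = _ := by ring
  have i3 : Integrable fun x => u x ^ 2 * (jap x ^ (-r) * deriv (japDeriv r) x) :=
    (i0.const_mul C).mono' (((u.continuous.pow 2).measurable.mul
      ((continuous_jap_rpow (-r)).measurable.mul (measurable_deriv _))).aestronglyMeasurable)
      (.of_forall hb)
  have hv x : deriv (u.japMul r) x = japDeriv r x * u x + jap x ^ (-r) * deriv u x := by
    have h1 := (hasDerivAt_jap_rpow r x).mul (u.hasDerivAt x)
    have h2 : ⇑(u.japMul r) = fun x => jap x ^ (-r) * u x := funext (u.japMul_apply r)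
    rw [h2]
    exact h1.deriv
  have h := integral_eq_zero_of_hasDerivAt_of_integrable
    (f := fun x => u x ^ 2 * (jap x ^ (-r) * japDeriv r x))
    (f' := (fun x => deriv (u.japMul r) x ^ 2) - (fun x => deriv u x ^ 2 * jap x ^ (-(2 * r)))
      + fun x => u x ^ 2 * (jap x ^ (-r) * deriv (japDeriv r) x)) (fun x => ?_)
      ((i1.sub i2).add i3)
    (u.integrable_sq_mul ((continuous_jap_rpow (-r)).mul (continuous_japDeriv r)) (c := 1 * (r * 1))
      fun x => ?_)
  · rw [integral_add' (i1.sub i2) i3, integral_sub' i1 i2] at h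
    have h3 := norm_integral_le_of_norm_le (f := fun x =>
      u x ^ 2 * (jap x ^ (-r) * deriv (japDeriv r) x)) (i0.const_mul C) (.of_forall hb)
    rw [integral_const_mul] at h3
    have h4 := (abs_le.1 h3).1
    linarith
  · refine (((u.hasDerivAt x).pow 2).mul
      ((hasDerivAt_jap_rpow r x).mul (hd x).1)).congr_deriv ?_
    simp only [Pi.pow_apply, Pi.sub_apply, Pi.add_apply, Pi.mul_apply]
    rw [hv, ← jap_rpow_neg_mul_self]
    push_cast
    ring
  · have h1 := jap_rpow_pos x (-r)
    have h2 := jap_rpow_neg_le_one hr x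
    rw [abs_mul, abs_of_pos h1]
    have h3 := (abs_japDeriv_le hr x).trans (mul_le_mul_of_nonneg_left h2 hr)
    exact mul_le_mul h2 h3 (abs_nonneg _) zero_le_one

theorem integral_norm_sq_fracD_one : ∫ x, ‖fracD (2 / 2) u.toComplex x‖ ^ 2
    = ∫ x, deriv u x ^ 2 := by
  have h := u.integral_mul_deriv_eq_neg_deriv_mul (SchwartzMap.derivCLM ℝ ℝ u)
  rw [integral_norm_sq_fracD_half zero_le_two]
  have e : ∀ x, fracD 2 u.toComplex x * conj (u.toComplex x)
      = ((-deriv (deriv u) x * u x : ℝ) : ℂ) := fun x => by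
    rw [coe_toComplex, fracD_two, Complex.conj_ofReal, ofReal_mul]
  simp only [e]
  rw [integral_complex_ofReal, ofReal_re]
  calc _ = -∫ x, u x * deriv (deriv u) x := by
        rw [← integral_neg]; congr 1 with x; ring
    _ = _ := by
        rw [show (∫ x, u x * deriv (deriv u) x) = _ from h, neg_neg]
        congr 1 with x
        rw [sq]; rfl

theorem exists_integral_fracD_le_two {r : ℝ} (hr : 1 / 2 < r) : ∃ C, 0 ≤ C ∧ ∀ u : 𝓢(ℝ, ℝ),
      (2 - 1) / 2 * ∫ x, ‖fracD (2 / 2) (u.japMul r).toComplex x‖ ^ 2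
        ≤ (∫ x, fracD 2 u.toComplex x * ((deriv u x * japPrimitive (2 * r) x : ℝ) : ℂ)).re
          + C * ∫ x, u x ^ 2 * jap x ^ (-(2 * r)) := by
  obtain ⟨C, hC, h⟩ := exists_integral_deriv_japMul_sq_le (by linarith : 0 ≤ r)
  refine ⟨1 / 2 * C, by positivity, fun u => ?_⟩
  rw [integral_norm_sq_fracD_one]
  have e : ∀ x, fracD 2 u.toComplex x * ((deriv u x * japPrimitive (2 * r) x : ℝ) : ℂ)
      = ((-deriv (deriv u) x * (deriv u x * japPrimitive (2 * r) x) : ℝ) : ℂ) := fun x => by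
    rw [coe_toComplex, fracD_two, ← ofReal_mul]
  simp only [e]
  rw [integral_complex_ofReal, ofReal_re,
    u.integral_neg_deriv_deriv_mul_deriv_mul_japPrimitive (by linarith)]
  linarith [h u]

end SchwartzMap

/-- Lemma 4.2: weighted Kato-type smoothing estimate
`∫(−|D|^α u)(∂ₓu)φ ≤ −((α−1)/2)∫(|D|^{α/2}(ϕu))² + C∫u²φ'`,
with `φ(x) = ∫_{-∞}^x ⟨s⟩^{-2r} ds` and `ϕ = ⟨x⟩^{-r}`. -/
theorem stmt_12 (α r : ℝ) (hα1 : 1 ≤ α) (hα2 : α ≤ 2) (hr1 : 1 / 2 < r)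
    (hr2 : r ≤ (α + 1) / 2) :
    ∃ C : ℝ, 0 < C ∧ ∀ u : SchwartzMap ℝ ℝ,
      (∫ x : ℝ, (-(fracD α (fun y => (u y : ℂ)) x))
          * ((deriv (fun y : ℝ => (u y : ℝ)) x : ℝ) : ℂ)
          * (((∫ s in Set.Iic x, jap s ^ (-(2 * r))) : ℝ) : ℂ)).re
        ≤ - ((α - 1) / 2)
            * (∫ x : ℝ, ‖fracD (α / 2) (fun y => ((jap y ^ (-r) * u y : ℝ) : ℂ)) x‖ ^ 2)
          + C * ∫ x : ℝ, u x ^ 2 * jap x ^ (-(2 * r)) := by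
  obtain ⟨C, hC, h⟩ : ∃ C, 0 ≤ C ∧ ∀ u : 𝓢(ℝ, ℝ),
      (α - 1) / 2 * ∫ x, ‖fracD (α / 2) (u.japMul r).toComplex x‖ ^ 2
        ≤ (∫ x, fracD α u.toComplex x * ((deriv u x * japPrimitive (2 * r) x : ℝ) : ℂ)).re
          + C * ∫ x, u x ^ 2 * jap x ^ (-(2 * r)) := by
    rcases hα2.lt_or_eq with hα2 | rfl
    · exact SchwartzMap.exists_integral_fracD_le_of_lt hα1 hα2 hr1 hr2
    · exact SchwartzMap.exists_integral_fracD_le_two hr1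
  refine ⟨C + 1, by linarith, fun u => ?_⟩
  have hU := u.integral_sq_mul_jap_nonneg (2 * r)
  have e1 : (fun y => ((jap y ^ (-r) * u y : ℝ) : ℂ)) = (u.japMul r).toComplex := by
    ext y
    rw [SchwartzMap.coe_toComplex, ← SchwartzMap.japMul_apply]
  have e2 : ∀ x, (-(fracD α (fun y => (u y : ℂ)) x))
          * ((deriv (fun y : ℝ => (u y : ℝ)) x : ℝ) : ℂ)
          * (((∫ s in Set.Iic x, jap s ^ (-(2 * r))) : ℝ) : ℂ)
      = -(fracD α u.toComplex x * ((deriv u x * japPrimitive (2 * r) x : ℝ) : ℂ)) := fun x => by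
    rw [SchwartzMap.coe_toComplex, japPrimitive, ofReal_mul]
    ring
  simp only [e2]
  rw [e1, integral_neg, neg_re]
  linarith [h u]
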